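/- arXiv:1303.5171 — 2 statements merged into one kernel-verified Lean document; each statement's English description precedes it below -/
import Mathlib

section
/- Let k ≥ 1 be a fixed integer and let M′ = M′(n) be a sequence of integers with M′ = (n/4)·(log n + (k+1)·log log n − log log log n + o(1)). Then almost surely κ(G(n, M′)) ≤ k − 1, where κ denotes the vertex connectivity. -/
open Filter Asymptotics
open scoped Classical

noncomputable section

/-- The number of edges of a simple graph on a finite vertex type. -/
def edgeCount {V : Type*} [Fintype V] (G : SimpleGraph V) : ℕ :=
  G.edgeFinset.card

/-- Probability in the Erdős–Rényi model `G(n,p)` of a set `A` of graphs on `Fin n`: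
each of the `n.choose 2` possible edges is present independently with probability `p`. -/
def gnpProb (n : ℕ) (p : ℝ) (A : Set (SimpleGraph (Fin n))) : ℝ :=
  ∑ G ∈ Finset.univ.filter (fun G => G ∈ A),
    p ^ edgeCount G * (1 - p) ^ (n.choose 2 - edgeCount G)

/-- Probability in the uniform model `G(n,M)` of a set `A` of graphs on `Fin n`:
all graphs with exactly `M` edges are equally likely. -/
def gnmProb (n M : ℕ) (A : Set (SimpleGraph (Fin n))) : ℝ :=
  ((Finset.univ.filter (fun G : SimpleGraph (Fin n) => edgeCount G = M ∧ G ∈ A)).card : ℝ) /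
    ((Finset.univ.filter (fun G : SimpleGraph (Fin n) => edgeCount G = M)).card : ℝ)

/-- `κ(S)`: the largest number of internally disjoint trees connecting `S`, i.e. trees
`T₁, …, T_k` of `G` with `S ⊆ V(Tᵢ)`, `V(Tᵢ) ∩ V(Tⱼ) = S` and `E(Tᵢ) ∩ E(Tⱼ) = ∅`
for `i ≠ j`. -/
def kappaSet {V : Type*} (G : SimpleGraph V) (S : Set V) : ℕ :=
  sSup {k | ∃ T : Fin k → G.Subgraph,
    (∀ i, S ⊆ (T i).verts ∧ ((T i).coe).IsTree) ∧
    (∀ i j, i ≠ j → (T i).verts ∩ (T j).verts = S ∧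
      (T i).edgeSet ∩ (T j).edgeSet = ∅)}

/-- `λ(S)`: the largest number of pairwise edge-disjoint trees of `G` each containing `S`. -/
def lambdaSet {V : Type*} (G : SimpleGraph V) (S : Set V) : ℕ :=
  sSup {k | ∃ T : Fin k → G.Subgraph,
    (∀ i, S ⊆ (T i).verts ∧ ((T i).coe).IsTree) ∧
    (∀ i j, i ≠ j → (T i).edgeSet ∩ (T j).edgeSet = ∅)}

/-- The generalized `r`-connectivity `κ_r(G)`: the minimum of `κ(S)` over `r`-subsets `S`,
and `0` if `G` is disconnected. -/
def genKappa {V : Type*} [Fintype V] (r : ℕ) (G : SimpleGraph V) : ℕ :=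
  if G.Connected then
    sInf {k | ∃ S : Finset V, S.card = r ∧ kappaSet G ↑S = k}
  else 0

/-- The generalized `r`-edge-connectivity `λ_r(G)`: the minimum of `λ(S)` over
`r`-subsets `S`, and `0` if `G` is disconnected. -/
def genLambda {V : Type*} [Fintype V] (r : ℕ) (G : SimpleGraph V) : ℕ :=
  if G.Connected then
    sInf {k | ∃ S : Finset V, S.card = r ∧ lambdaSet G ↑S = k}
  else 0

/-- The vertex connectivity `κ(G)`: the largest `k` such that `G` is `k`-connected,
i.e. `k < |V|` and the removal of fewer than `k` vertices leaves a connected graph. -/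
def vertexConnectivity {V : Type*} [Fintype V] (G : SimpleGraph V) : ℕ :=
  sSup {k | k < Fintype.card V ∧
    ∀ S : Finset V, S.card < k → (G.induce ((↑S : Set V)ᶜ)).Connected}

/-- The edge connectivity `λ(G)`: the largest `k` such that removing fewer than `k`
edges always leaves a connected graph. -/
def edgeConnectivity {V : Type*} [Fintype V] (G : SimpleGraph V) : ℕ :=
  sSup {k | ∀ F : Finset (Sym2 V), F.card < k → (G.deleteEdges ↑F).Connected}

/-- The minimum degree `δ(G)`. -/
def minDeg {V : Type*} [Fintype V] (G : SimpleGraph V) : ℕ :=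
  G.minDegree

/-- The number of children of `v` in the graph `H` viewed as rooted at `r`:
neighbours of `v` lying one step further from the root. -/
def childCount {W : Type*} (H : SimpleGraph W) (r v : W) : ℕ :=
  {w | H.Adj v w ∧ H.dist r w = H.dist r v + 1}.ncard

/-- The depth of the graph `H` viewed as rooted at `r`: the largest distance from `r`. -/
def rootedDepth {W : Type*} (H : SimpleGraph W) (r : W) : ℕ :=
  sSup (Set.range (H.dist r))

/-- `T` is a subtree of `G` rooted at `r`, of depth `d`, in which every non-leaf
vertex has exactly `t` children (a `t`-ary tree of depth `d`). -/
def IsAryTreeOfDepth {V : Type*} {G : SimpleGraph V} (T : G.Subgraph) (r : V)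
    (t d : ℕ) : Prop :=
  ∃ hr : r ∈ T.verts,
    T.coe.IsTree ∧ rootedDepth T.coe ⟨r, hr⟩ = d ∧
      ∀ v : T.verts, childCount T.coe ⟨r, hr⟩ v = 0 ∨ childCount T.coe ⟨r, hr⟩ v = t

end

section Choose

/-- One step of log-concavity of `m ↦ m.choose M`. -/
theorem choose_succ_mul_choose_le {l m : ℕ} (h : l ≤ m) (M : ℕ) :
    (m + 1).choose M * l.choose M ≤ m.choose M * (l + 1).choose M := by
  rcases Nat.lt_or_ge l M with hl | hl
  · simp [Nat.choose_eq_zero_of_lt hl]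
  obtain ⟨d, rfl⟩ := Nat.exists_eq_add_of_le hl
  obtain ⟨f, rfl⟩ := Nat.exists_eq_add_of_le h
  have h1 := Nat.choose_mul_succ_eq (M + d) M
  have h2 := Nat.choose_mul_succ_eq (M + d + f) M
  rw [show M + d + 1 - M = d + 1 by omega] at h1
  rw [show M + d + f + 1 - M = d + f + 1 by omega] at h2
  generalize (M + d).choose M = a at *
  generalize (M + d + 1).choose M = a' at *
  generalize (M + d + f).choose M = b at *
  generalize (M + d + f + 1).choose M = b' at *
  refine Nat.le_of_mul_le_mul_right (c := (d + f + 1) * (M + d + 1)) ?_ (by positivity)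
  calc b' * a * ((d + f + 1) * (M + d + 1))
      = (b' * (d + f + 1)) * (a * (M + d + 1)) := by ring
    _ = b * a' * ((M + d + f + 1) * (d + 1)) := by rw [← h2, h1]; ring
    _ ≤ b * a' * ((d + f + 1) * (M + d + 1)) := by
      refine Nat.mul_le_mul_left _ ?_
      nlinarith [Nat.zero_le (M * f)]

/-- Log-concavity of `m ↦ m.choose M`. -/
theorem choose_add_mul_choose_le (s t u M : ℕ) :
    (u + s + t).choose M * u.choose M ≤ (u + s).choose M * (u + t).choose M := by
  induction t with
  | zero => simp
  | succ t ih =>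
    have h := choose_succ_mul_choose_le (show u + t ≤ u + s + t by omega) M
    rcases Nat.eq_zero_or_pos ((u + t).choose M) with h0 | h0
    · have : u.choose M = 0 :=
        Nat.le_zero.1 (h0 ▸ Nat.choose_le_choose M (Nat.le_add_right u t))
      simp [this]
    refine Nat.le_of_mul_le_mul_right (c := (u + t).choose M) ?_ h0
    calc (u + s + (t + 1)).choose M * u.choose M * (u + t).choose M
        = ((u + s + t + 1).choose M * (u + t).choose M) * u.choose M := by
          rw [← add_assoc]; ring
      _ ≤ ((u + s + t).choose M * (u + t + 1).choose M) * u.choose M := by gcongr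
      _ = ((u + s + t).choose M * u.choose M) * (u + t + 1).choose M := by ring
      _ ≤ ((u + s).choose M * (u + t).choose M) * (u + t + 1).choose M := by gcongr
      _ = (u + s).choose M * (u + (t + 1)).choose M * (u + t).choose M := by
          rw [← add_assoc u t 1]; ring

theorem choose_succ_mul_one_sub_div {m M : ℕ} (h : M ≤ m + 1) :
    ((m + 1).choose M : ℝ) * (1 - M / (m + 1)) = m.choose M := by
  have h1 := Nat.choose_mul_succ_eq m M
  have h2 : (m.choose M : ℝ) * (m + 1) = (m + 1).choose M * (m + 1 - M) := by
    have := congrArg (Nat.cast (R := ℝ)) h1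
    simp only [Nat.cast_mul, Nat.cast_add, Nat.cast_one, Nat.cast_sub h] at this
    exact this
  field_simp
  linarith

theorem choose_add_mul_one_sub_div_pow_le {D M : ℕ} (h : M ≤ D + 1) (j : ℕ) :
    ((D + j).choose M : ℝ) * (1 - M / (D + 1)) ^ j ≤ D.choose M := by
  have h0 : (0 : ℝ) ≤ 1 - M / (D + 1) := by
    rw [sub_nonneg, div_le_one (by positivity)]
    exact_mod_cast h
  induction j with
  | zero => simp
  | succ j ih =>
    refine le_trans ?_ ih
    have h1 := choose_succ_mul_one_sub_div (show M ≤ D + j + 1 by omega)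
    rw [pow_succ', ← mul_assoc]
    refine mul_le_mul_of_nonneg_right ?_ (pow_nonneg h0 _)
    rw [← h1, ← add_assoc]
    gcongr
    linarith [Nat.cast_nonneg (α := ℝ) j]

end Choose

section Counting

variable {V : Type*} [Fintype V]

/-- Number of graphs with `M` edges avoiding a given set of edges of the complete graph. -/
theorem card_filter_edgeCount_disjoint (M : ℕ) (F : Finset (Sym2 V))
    (hF : F ⊆ (⊤ : SimpleGraph V).edgeFinset) :
    (Finset.univ.filter (fun G : SimpleGraph V =>
      edgeCount G = M ∧ Disjoint G.edgeFinset F)).card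
      = ((Fintype.card V).choose 2 - F.card).choose M := by
  rw [← SimpleGraph.card_edgeFinset_top_eq_card_choose_two, ← Finset.card_sdiff_of_subset hF,
    ← Finset.card_powersetCard]
  refine Finset.card_bij (fun G _ => G.edgeFinset) ?_ ?_ ?_
  · intro G hG
    simp only [Finset.mem_filter, Finset.mem_univ, true_and] at hG
    rw [Finset.mem_powersetCard]
    refine ⟨Finset.subset_sdiff.2 ⟨SimpleGraph.edgeFinset_mono le_top, hG.2⟩, hG.1⟩
  · intro G _ H _ h
    exact SimpleGraph.edgeFinset_inj.1 h
  · intro E hE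
    rw [Finset.mem_powersetCard, Finset.subset_sdiff] at hE
    have hmem : ∀ (H : SimpleGraph V) (e : Sym2 V), e ∈ H.edgeFinset ↔ e ∈ H.edgeSet :=
      fun _ _ => SimpleGraph.mem_edgeFinset
    obtain ⟨H, hH⟩ : ∃ H : SimpleGraph V, H.edgeFinset = E := by
      refine ⟨SimpleGraph.fromEdgeSet (E : Set (Sym2 V)), ?_⟩
      ext e
      refine (hmem _ _).trans ?_
      rw [SimpleGraph.edgeSet_fromEdgeSet]
      simp only [Set.mem_sdiff, Finset.mem_coe]
      refine ⟨fun h => h.1, fun h => ⟨h, ?_⟩⟩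
      have h1 := hE.1.1 h
      rw [SimpleGraph.mem_edgeFinset] at h1
      simpa using SimpleGraph.not_isDiag_of_mem_edgeSet _ h1
    refine ⟨H, ?_, hH⟩
    rw [Finset.mem_filter]
    exact ⟨Finset.mem_univ _, (by rw [edgeCount, hH, hE.2]), (by rw [hH]; exact hE.1.2)⟩

theorem isolated_iff_disjoint_incidenceFinset (G : SimpleGraph V) (v : V) :
    G.IsIsolated v ↔ Disjoint G.edgeFinset ((⊤ : SimpleGraph V).incidenceFinset v) := by
  rw [Finset.disjoint_left]
  constructor
  · intro h e he hv
    rw [SimpleGraph.mem_incidenceFinset] at hv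
    obtain ⟨w, rfl⟩ := Sym2.mem_iff_exists.1 hv.2
    rw [SimpleGraph.mem_edgeFinset, SimpleGraph.mem_edgeSet] at he
    exact h w he
  · intro h w hw
    refine h (a := s(v, w)) (by simpa using hw) ?_
    rw [SimpleGraph.mem_incidenceFinset]
    exact ⟨by simpa using hw.ne, by simp⟩

theorem card_filter_edgeCount (M : ℕ) :
    (Finset.univ.filter (fun G : SimpleGraph V => edgeCount G = M)).card
      = ((Fintype.card V).choose 2).choose M := by
  simpa using card_filter_edgeCount_disjoint (V := V) M ∅ (by simp)

theorem card_filter_edgeCount_isolated (M : ℕ) (v : V) :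
    (Finset.univ.filter (fun G : SimpleGraph V => edgeCount G = M ∧ G.IsIsolated v)).card
      = ((Fintype.card V).choose 2 - (Fintype.card V - 1)).choose M := by
  simp only [isolated_iff_disjoint_incidenceFinset]
  rw [card_filter_edgeCount_disjoint M _ (SimpleGraph.incidenceFinset_subset _ _),
    SimpleGraph.card_incidenceFinset_eq_degree, SimpleGraph.complete_graph_degree]

theorem card_filter_edgeCount_isolated_pair_le (M : ℕ) {u v : V} (huv : u ≠ v) :
    (Finset.univ.filter (fun G : SimpleGraph V =>
      edgeCount G = M ∧ G.IsIsolated u ∧ G.IsIsolated v)).card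
      ≤ ((Fintype.card V).choose 2 - (2 * Fintype.card V - 3)).choose M := by
  simp only [isolated_iff_disjoint_incidenceFinset, ← Finset.disjoint_union_right]
  rw [card_filter_edgeCount_disjoint M _ (Finset.union_subset
    (SimpleGraph.incidenceFinset_subset _ _) (SimpleGraph.incidenceFinset_subset _ _))]
  refine Nat.choose_le_choose _ (Nat.sub_le_sub_left ?_ _)
  have hinter : ((⊤ : SimpleGraph V).incidenceFinset u ∩
      (⊤ : SimpleGraph V).incidenceFinset v).card ≤ 1 := by
    rw [Finset.card_le_one]
    have hmem : ∀ e ∈ (⊤ : SimpleGraph V).incidenceFinset u ∩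
        (⊤ : SimpleGraph V).incidenceFinset v, e = s(u, v) := by
      intro e he
      simp only [Finset.mem_inter, SimpleGraph.mem_incidenceFinset] at he
      exact (Sym2.mem_and_mem_iff huv).1 ⟨he.1.2, he.2.2⟩
    intro a ha b hb
    rw [hmem a ha, hmem b hb]
  have h := Finset.card_union_add_card_inter ((⊤ : SimpleGraph V).incidenceFinset u)
    ((⊤ : SimpleGraph V).incidenceFinset v)
  simp only [SimpleGraph.card_incidenceFinset_eq_degree, SimpleGraph.complete_graph_degree] at h
  omega

/-- The second moment method in counting form. -/
theorem sq_sum_card_le_card_mul {α ι : Type*} [Fintype ι] (Ω : Finset α) (P : α → ι → Prop) :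
    (∑ i, ((Ω.filter (fun x => P x i)).card : ℝ)) ^ 2 ≤
      (Ω.filter (fun x => ∃ i, P x i)).card *
        ∑ i, ∑ j, ((Ω.filter (fun x => P x i ∧ P x j)).card : ℝ) := by
  set S := Ω.filter (fun x => ∃ i, P x i)
  let X : α → ℝ := fun x => ∑ i, if P x i then 1 else 0
  have h1 : ∑ i, ((Ω.filter (fun x => P x i)).card : ℝ) = ∑ x ∈ S, X x := by
    rw [Finset.sum_comm]
    refine Finset.sum_congr rfl fun i _ => ?_
    rw [Finset.sum_boole, Finset.filter_filter]
    congr 2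
    ext x
    simp only [Finset.mem_filter]
    exact ⟨fun h => ⟨h.1, ⟨i, h.2⟩, h.2⟩, fun h => ⟨h.1, h.2.2⟩⟩
  have h2 : ∑ i, ∑ j, ((Ω.filter (fun x => P x i ∧ P x j)).card : ℝ) = ∑ x ∈ S, X x ^ 2 := by
    have : ∀ x, X x ^ 2 = ∑ i, ∑ j, if P x i ∧ P x j then (1 : ℝ) else 0 := by
      intro x
      rw [sq, Finset.sum_mul_sum]
      refine Finset.sum_congr rfl fun i _ => Finset.sum_congr rfl fun j _ => ?_
      by_cases hi : P x i <;> by_cases hj : P x j <;> simp [hi, hj]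
    symm
    rw [Finset.sum_congr rfl fun x _ => this x, Finset.sum_comm]
    refine Finset.sum_congr rfl fun i _ => ?_
    rw [Finset.sum_comm]
    refine Finset.sum_congr rfl fun j _ => ?_
    rw [Finset.sum_boole, Finset.filter_filter]
    congr 2
    ext x
    simp only [Finset.mem_filter]
    exact ⟨fun h => ⟨h.1, h.2.2⟩, fun h => ⟨h.1, ⟨i, h.2.1⟩, h.2⟩⟩
  rw [h1, h2]
  exact sq_sum_le_card_mul_sum_sq

theorem vertexConnectivity_eq_zero_of_isolated [Nontrivial V] {G : SimpleGraph V} {v : V}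
    (hv : G.IsIsolated v) : vertexConnectivity G = 0 := by
  refine Nat.le_zero.1 (csSup_le' ?_)
  rintro j ⟨-, hj⟩
  by_contra hpos
  have hconn := hj ∅ (by simp only [Finset.card_empty]; omega)
  obtain ⟨w, hw⟩ := exists_ne v
  have : Nontrivial ↑((↑(∅ : Finset V) : Set V)ᶜ) :=
    ⟨⟨v, by simp⟩, ⟨w, by simp⟩, fun h => hw (congrArg Subtype.val h).symm⟩
  obtain ⟨x, hx⟩ := hconn.preconnected.exists_adj_of_nontrivial ⟨v, by simp⟩
  exact hv _ hx

end Counting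

theorem gnmProb_le_one (n M : ℕ) (A : Set (SimpleGraph (Fin n))) : gnmProb n M A ≤ 1 := by
  refine div_le_one_of_le₀ ?_ (Nat.cast_nonneg _)
  exact_mod_cast Finset.card_le_card fun G hG => by
    simp only [Finset.mem_filter] at hG ⊢
    exact ⟨hG.1, hG.2.1⟩

/-- Second-moment lower bound for the probability that `G(n,M)` has an isolated vertex. -/
theorem le_gnmProb_isolated {n M D : ℕ} (hn : 3 ≤ n) (hD : n.choose 2 = D + (n - 1))
    (hM : M ≤ D) :
    (((n.choose 2).choose M : ℝ) / (n * D.choose M) + (1 - (M : ℝ) / (D + 1))⁻¹)⁻¹ ≤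
      gnmProb n M {G | ∃ v, G.IsIsolated v} := by
  have hmoment := sq_sum_card_le_card_mul
    (Finset.univ.filter (fun G : SimpleGraph (Fin n) => edgeCount G = M))
    (fun G v => G.IsIsolated v)
  simp only [Finset.filter_filter] at hmoment
  obtain ⟨u, hu⟩ : ∃ u, D = u + (n - 2) := by
    refine ⟨D - (n - 2), ?_⟩
    have h2 : n.choose 2 ≥ (n - 1) + (n - 2) := by
      obtain ⟨m, rfl⟩ := Nat.exists_eq_add_of_le hn
      have h1 : (3 + m).choose 2 = (m + 1).choose 2 + (m + 1) + (m + 2) := by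
        rw [show 3 + m = m + 1 + 1 + 1 by ring, Nat.choose_succ_succ' (m + 1 + 1) 1,
          Nat.choose_succ_succ' (m + 1) 1]
        simp only [Nat.choose_one_right, Nat.reduceAdd]
        omega
      omega
    omega
  have hfirst : ∀ v : Fin n, (Finset.univ.filter (fun G : SimpleGraph (Fin n) =>
      edgeCount G = M ∧ G.IsIsolated v)).card = D.choose M := by
    intro v
    have h := card_filter_edgeCount_isolated M v
    rw [Fintype.card_fin, hD, Nat.add_sub_cancel] at h
    convert h
  have hpair : ∀ i j : Fin n, ((Finset.univ.filter (fun G : SimpleGraph (Fin n) =>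
      edgeCount G = M ∧ G.IsIsolated i ∧ G.IsIsolated j)).card : ℝ) ≤
      (if i = j then (D.choose M : ℝ) else 0) + u.choose M := by
    intro i j
    split_ifs with hij
    · subst hij
      simp only [and_self, hfirst]
      simp
    · have h := card_filter_edgeCount_isolated_pair_le M hij
      rw [Fintype.card_fin, show n.choose 2 - (2 * n - 3) = u by omega] at h
      rw [zero_add, Nat.cast_le]
      convert h
  have hsecond : ∑ i : Fin n, ∑ j : Fin n, ((Finset.univ.filter (fun G : SimpleGraph (Fin n) =>
      edgeCount G = M ∧ G.IsIsolated i ∧ G.IsIsolated j)).card : ℝ) ≤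
      n * D.choose M + n ^ 2 * u.choose M := by
    refine (Finset.sum_le_sum fun i _ => Finset.sum_le_sum fun j _ => hpair i j).trans_eq ?_
    simp [Finset.sum_add_distrib]
    ring
  simp only [hfirst, Finset.sum_const, Finset.card_univ, Fintype.card_fin, nsmul_eq_mul]
    at hmoment
  have hconc := choose_add_mul_choose_le (n - 2) (n - 1) u M
  rw [← hu, ← hD, show u + (n - 1) = D + 1 by omega] at hconc
  have hstep := choose_succ_mul_one_sub_div (show M ≤ D + 1 by omega)
  have ha : (0 : ℝ) < D.choose M := by exact_mod_cast Nat.choose_pos hM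
  have hc : (0 : ℝ) < (n.choose 2).choose M := by
    exact_mod_cast Nat.choose_pos (by omega)
  have hx : (0 : ℝ) < 1 - M / (D + 1) := by
    rw [sub_pos, div_lt_one (by positivity)]
    exact_mod_cast Nat.lt_succ_of_le hM
  have hn0 : (0 : ℝ) < n := by exact_mod_cast (by omega : 0 < n)
  have hconc' : ((n.choose 2).choose M : ℝ) * u.choose M ≤
      D.choose M * (D + 1).choose M := by exact_mod_cast hconc
  have htotal : (Finset.univ.filter (fun G : SimpleGraph (Fin n) => edgeCount G = M)).card =
      (n.choose 2).choose M := by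
    have h := card_filter_edgeCount (V := Fin n) M
    rw [Fintype.card_fin] at h
    convert h
  rw [gnmProb, htotal]
  simp only [Set.mem_ofPred_eq]
  set X : ℝ := ((Finset.univ.filter (fun G : SimpleGraph (Fin n) =>
    edgeCount G = M ∧ ∃ v, G.IsIsolated v)).card : ℝ) with hX
  have hX0 : 0 ≤ X := Nat.cast_nonneg _
  have hmom : ((n : ℝ) * D.choose M) ^ 2 ≤ X * (n * D.choose M + n ^ 2 * u.choose M) := by
    refine (hmoment.trans_eq ?_).trans (mul_le_mul_of_nonneg_left hsecond hX0)
    rw [hX]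
    congr!
  generalize ((D + 1).choose M : ℝ) = a' at *
  generalize (D.choose M : ℝ) = a at *
  generalize ((n.choose 2).choose M : ℝ) = c at *
  generalize (u.choose M : ℝ) = b at *
  generalize (1 - (M : ℝ) / (D + 1)) = y at *
  clear_value X
  have ha' : a' = a * y⁻¹ := by rw [← hstep]; field_simp
  rw [inv_le_iff_one_le_mul₀ (by positivity)]
  have key : c * (n * a + n ^ 2 * b) ≤ (n * a) ^ 2 * (c / (n * a) + y⁻¹) := by
    have e1 : (n * a) ^ 2 * (c / (n * a) + y⁻¹) = c * (n * a) + n ^ 2 * (a * (a * y⁻¹)) := by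
      field_simp
    rw [e1, ← ha', mul_add]
    have := mul_le_mul_of_nonneg_left hconc' (sq_nonneg (n : ℝ))
    linarith
  have hT : 0 < c / (n * a) + y⁻¹ := by positivity
  have h3 : c * (n * a) ^ 2 ≤ X * ((n * a) ^ 2 * (c / (n * a) + y⁻¹)) :=
    calc c * (n * a) ^ 2 ≤ c * (X * (n * a + n ^ 2 * b)) :=
          mul_le_mul_of_nonneg_left hmom hc.le
      _ = X * (c * (n * a + n ^ 2 * b)) := by ring
      _ ≤ _ := mul_le_mul_of_nonneg_left key hX0
  have h4 : c ≤ X * (c / (n * a) + y⁻¹) := by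
    refine le_of_mul_le_mul_right (a := (n * a) ^ 2) ?_ (by positivity)
    linarith
  rw [div_mul_eq_mul_div, one_le_div hc]
  exact h4

/-- A graph with at most `n log n / 3` edges a.s. has an isolated vertex. -/
theorem tendsto_gnmProb_isolated (M : ℕ → ℕ)
    (hM : ∀ᶠ n : ℕ in atTop, (M n : ℝ) ≤ n * Real.log n / 3) :
    Tendsto (fun n : ℕ => gnmProb n (M n) {G | ∃ v, G.IsIsolated v}) atTop (nhds 1) := by
  have hlogn : Tendsto (fun n : ℕ => Real.log n / n) atTop (nhds 0) := by
    exact (Real.isLittleO_log_id_atTop.tendsto_div_nhds_zero).comp tendsto_natCast_atTop_atTop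
  have hsmall : ∀ᶠ n : ℕ in atTop, Real.log n / n ≤ 1 / 15 :=
    hlogn.eventually_le_const (by norm_num)
  have hpow : Tendsto (fun n : ℕ => ((n : ℝ) ^ (1 / 4 : ℝ))⁻¹) atTop (nhds 0) :=
    ((tendsto_rpow_atTop (by norm_num)).comp tendsto_natCast_atTop_atTop).inv_tendsto_atTop
  have hlow : Tendsto (fun n : ℕ =>
      (((n : ℝ) ^ (1 / 4 : ℝ))⁻¹ + (1 - 7 / 10 * (Real.log n / n))⁻¹)⁻¹) atTop (nhds 1) := by
    have h1 : Tendsto (fun n : ℕ => (1 - 7 / 10 * (Real.log n / n))⁻¹) atTop (nhds 1) := by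
      have := ((hlogn.const_mul (7 / 10)).const_sub 1).inv₀ (by norm_num)
      simpa using this
    have := (hpow.add h1).inv₀ (by norm_num)
    simpa using this
  refine tendsto_of_tendsto_of_tendsto_of_le_of_le' hlow tendsto_const_nhds ?_
    (Eventually.of_forall fun n => gnmProb_le_one _ _ _)
  filter_upwards [hM, hsmall, eventually_ge_atTop 100] with n hMn hs hn
  obtain ⟨D, hD⟩ : ∃ D, n.choose 2 = D + (n - 1) := by
    refine ⟨(n - 1).choose 2, ?_⟩
    obtain ⟨m, rfl⟩ := Nat.exists_eq_add_of_le' (show 1 ≤ n by omega)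
    rw [Nat.choose_succ_succ' m 1]
    simp [add_comm]
  have hnR : (100 : ℝ) ≤ n := by exact_mod_cast hn
  have hDR : (D : ℝ) + 1 = (n ^ 2 - 3 * n + 4) / 2 := by
    have h1 : ((n.choose 2 : ℕ) : ℝ) = D + (n - 1) := by
      rw [hD]; push_cast [Nat.cast_sub (show 1 ≤ n by omega)]; ring
    rw [Nat.cast_choose_two] at h1
    linarith
  have hlog0 : 0 ≤ Real.log n := Real.log_nonneg (by linarith)
  have hD20 : 20 / 21 * (n : ℝ) ^ 2 / 2 ≤ D + 1 := by rw [hDR]; nlinarith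
  have hx : (M n : ℝ) / (D + 1) ≤ 7 / 10 * (Real.log n / n) := by
    rw [div_le_iff₀ (by positivity)]
    calc (M n : ℝ) ≤ n * Real.log n / 3 := hMn
      _ = 7 / 10 * (Real.log n / n) * (20 / 21 * (n : ℝ) ^ 2 / 2) := by field_simp; ring
      _ ≤ _ := by gcongr
  have hx15 : (M n : ℝ) / (D + 1) ≤ 1 / 15 := by
    have : 0 ≤ Real.log n / n := by positivity
    linarith
  have hMD : M n ≤ D := by
    rw [div_le_iff₀ (by positivity)] at hx15
    have : (M n : ℝ) ≤ D := by nlinarith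
    exact_mod_cast this
  refine le_trans ?_ (le_gnmProb_isolated (by omega) hD hMD)
  have hchoose := choose_add_mul_one_sub_div_pow_le (show M n ≤ D + 1 by omega) (n - 1)
  rw [← hD] at hchoose
  have hx0 : 0 ≤ (M n : ℝ) / (D + 1) := by positivity
  set x := (M n : ℝ) / (D + 1) with hxdef
  have ha : (0 : ℝ) < D.choose (M n) := by exact_mod_cast Nat.choose_pos hMD
  have hc : (0 : ℝ) < (n.choose 2).choose (M n) := by
    exact_mod_cast Nat.choose_pos (by omega)
  have hy : 0 < 1 - x := by linarith
  have hpowlow : (n : ℝ) ^ (-(3 / 4) : ℝ) ≤ (1 - x) ^ (n - 1) := by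
    rw [← Real.exp_log hy, ← Real.exp_nat_mul, Real.rpow_def_of_pos (by linarith)]
    refine Real.exp_le_exp.2 ?_
    have h1 := Real.one_sub_inv_le_log_of_pos hy
    have h2 : -(15 / 14 * x) ≤ 1 - (1 - x)⁻¹ := by
      have : (1 - x)⁻¹ ≤ 1 + 15 / 14 * x := by
        rw [inv_le_iff_one_le_mul₀ hy]
        nlinarith
      linarith
    have h3 : ((n - 1 : ℕ) : ℝ) ≤ n := by exact_mod_cast Nat.sub_le n 1
    have h4 : ((n - 1 : ℕ) : ℝ) * (15 / 14 * x) ≤ 3 / 4 * Real.log n := by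
      calc ((n - 1 : ℕ) : ℝ) * (15 / 14 * x)
          ≤ n * (15 / 14 * (7 / 10 * (Real.log n / n))) := by gcongr
        _ = 3 / 4 * Real.log n := by field_simp; ring
    have h5 : ((n - 1 : ℕ) : ℝ) * -(15 / 14 * x) ≤ ((n - 1 : ℕ) : ℝ) * Real.log (1 - x) :=
      mul_le_mul_of_nonneg_left (h2.trans h1) (Nat.cast_nonneg _)
    linarith
  have hratio : ((n.choose 2).choose (M n) : ℝ) / (n * D.choose (M n)) ≤
      ((n : ℝ) ^ (1 / 4 : ℝ))⁻¹ := by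
    have hn0 : (0 : ℝ) < n := by linarith
    rw [div_le_iff₀ (by positivity), ← Real.rpow_neg hn0.le, ← mul_assoc]
    nth_rewrite 2 [← Real.rpow_one (n : ℝ)]
    rw [← Real.rpow_add hn0, ← div_le_iff₀' (by positivity), div_eq_mul_inv,
      ← Real.rpow_neg hn0.le]
    refine le_trans ?_ hchoose
    refine mul_le_mul_of_nonneg_left (le_of_eq_of_le ?_ hpowlow) hc.le
    norm_num
  have hxlog : 0 < 1 - 7 / 10 * (Real.log n / n) := by linarith
  gcongr

theorem eventually_le_mul_log_div_three (k : ℕ) (M' : ℕ → ℕ) (e : ℕ → ℝ)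
    (he : Tendsto e atTop (nhds 0))
    (hM : ∀ n : ℕ, (M' n : ℝ) = (n : ℝ) / 4 * (Real.log n +
      ((k : ℝ) + 1) * Real.log (Real.log n) - Real.log (Real.log (Real.log n)) + e n)) :
    ∀ᶠ n : ℕ in atTop, (M' n : ℝ) ≤ n * Real.log n / 3 := by
  have hlog : Tendsto (fun n : ℕ => Real.log n) atTop atTop :=
    Real.tendsto_log_atTop.comp tendsto_natCast_atTop_atTop
  have hloglog : Tendsto (fun n : ℕ => Real.log (Real.log n)) atTop atTop :=
    Real.tendsto_log_atTop.comp hlog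
  have hlittle := hlog.eventually (Real.isLittleO_log_id_atTop.bound
    (show (0 : ℝ) < 1 / (6 * (k + 1)) by positivity))
  filter_upwards [hlittle, hlog.eventually_ge_atTop 6, hloglog.eventually_ge_atTop 1,
    he.eventually_le_const zero_lt_one] with n h1 h2 h3 h4
  have h5 : 0 ≤ Real.log (Real.log (Real.log n)) := Real.log_nonneg h3
  have h6 : ((k : ℝ) + 1) * Real.log (Real.log n) ≤ Real.log n / 6 := by
    simp only [id, Real.norm_eq_abs] at h1
    rw [abs_of_nonneg (by linarith), abs_of_nonneg (by linarith)] at h1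
    calc ((k : ℝ) + 1) * Real.log (Real.log n)
        ≤ (k + 1) * (1 / (6 * (k + 1)) * Real.log n) := by gcongr
      _ = Real.log n / 6 := by field_simp
  rw [hM]
  calc (n : ℝ) / 4 * (Real.log n + ((k : ℝ) + 1) * Real.log (Real.log n) -
        Real.log (Real.log (Real.log n)) + e n)
      ≤ n / 4 * (4 / 3 * Real.log n) := by gcongr; linarith
    _ = n * Real.log n / 3 := by ring

/-- If `M′ = (n/4)(log n + (k+1) log log n − log log log n + o(1))`, then almost surely
`κ(G(n, M′)) ≤ k − 1`. -/
theorem gnm_vertexConnectivity_le_as (k : ℕ) (hk : 1 ≤ k) (M' : ℕ → ℕ) (e : ℕ → ℝ)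
    (he : Tendsto e atTop (nhds 0))
    (hM : ∀ n : ℕ, (M' n : ℝ) = (n : ℝ) / 4 * (Real.log n +
      ((k : ℝ) + 1) * Real.log (Real.log n) - Real.log (Real.log (Real.log n)) + e n)) :
    Tendsto (fun n : ℕ =>
      gnmProb n (M' n) {G : SimpleGraph (Fin n) | vertexConnectivity G ≤ k - 1})
      atTop (nhds 1) := by
  refine tendsto_of_tendsto_of_tendsto_of_le_of_le' (tendsto_gnmProb_isolated M'
    (eventually_le_mul_log_div_three k M' e he hM)) tendsto_const_nhds ?_
    (Eventually.of_forall fun n => gnmProb_le_one _ _ _)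
  filter_upwards [eventually_ge_atTop 2] with n hn
  have : Nontrivial (Fin n) := Fin.nontrivial_iff_two_le.2 hn
  unfold gnmProb
  gcongr with G
  rintro ⟨v, hv⟩
  simp [vertexConnectivity_eq_zero_of_isolated hv]
end

section
/- Let k ∈ ℕ and y ∈ ℝ be fixed, and let M = M(n) be a sequence of integers with M = (n/2)·(log n + k·log log n + y + o(1)). Then Pr[κ(G(n,M)) = k] → 1 − exp(−e^{−y}/k!) and Pr[κ(G(n,M)) = k+1] → exp(−e^{−y}/k!) as n → ∞, where κ denotes the vertex connectivity. -/
open Filter Asymptotics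
open scoped Classical

/-- The graphs on `Fin n` with exactly `M` edges. -/
noncomputable def gnmGraphs (n M : ℕ) : Finset (SimpleGraph (Fin n)) :=
  Finset.univ.filter fun G => edgeCount G = M

lemma mem_gnmGraphs {n M : ℕ} {G : SimpleGraph (Fin n)} :
    G ∈ gnmGraphs n M ↔ edgeCount G = M := by
  simp [gnmGraphs]

/-- The graphs with `M` edges containing the edge set `A` and avoiding the edge set `B`. -/
lemma card_gnmGraphs_filter_edges {n M : ℕ} {A B : Finset (Sym2 (Fin n))}
    (hA : ∀ e ∈ A, ¬ e.IsDiag) (hB : ∀ e ∈ B, ¬ e.IsDiag) (hAB : Disjoint A B)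
    (hM : A.card ≤ M) :
    ((gnmGraphs n M).filter fun G => A ⊆ G.edgeFinset ∧ Disjoint B G.edgeFinset).card =
      (n.choose 2 - (A.card + B.card)).choose (M - A.card) := by
  set E : Finset (Sym2 (Fin n)) := (⊤ : SimpleGraph (Fin n)).edgeFinset with hE
  have hmemE : ∀ e, e ∈ E ↔ ¬ e.IsDiag := by
    intro e; simp [hE]
  have hEc : E.card = n.choose 2 := by
    have := SimpleGraph.card_edgeFinset_top_eq_card_choose_two (V := Fin n)
    simpa [hE] using this
  have hAE : A ∪ B ⊆ E := by
    intro e he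
    rw [hmemE]
    rcases Finset.mem_union.1 he with h | h
    · exact hA e h
    · exact hB e h
  rw [← hEc, ← Finset.card_union_of_disjoint hAB, ← Finset.card_sdiff_of_subset hAE,
    ← Finset.card_powersetCard]
  refine Finset.card_bij' (fun G _ => G.edgeFinset \ A)
    (fun F _ => SimpleGraph.fromEdgeSet (↑(A ∪ F) : Set (Sym2 (Fin n)))) ?_ ?_ ?_ ?_
  · intro G hG
    simp only [Finset.mem_filter, mem_gnmGraphs, edgeCount] at hG
    obtain ⟨h1, h2, h3⟩ := hG
    rw [Finset.mem_powersetCard]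
    refine ⟨?_, by rw [Finset.card_sdiff_of_subset h2, ← h1]⟩
    intro e he
    rw [Finset.mem_sdiff] at he
    rw [Finset.mem_sdiff, hmemE, Finset.mem_union]
    refine ⟨G.not_isDiag_of_mem_edgeFinset he.1, ?_⟩
    rintro (h | h)
    · exact he.2 h
    · exact (Finset.disjoint_left.1 h3 h) he.1
  · intro F hF
    rw [Finset.mem_powersetCard] at hF
    have hef : ∀ H : SimpleGraph (Fin n),
        H = SimpleGraph.fromEdgeSet (↑(A ∪ F) : Set (Sym2 (Fin n))) → H.edgeFinset = A ∪ F := by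
      intro H hH
      ext e
      rw [SimpleGraph.mem_edgeFinset, hH, SimpleGraph.edgeSet_fromEdgeSet]
      simp only [Set.mem_sdiff, Finset.mem_coe, Sym2.mem_diagSet, and_iff_left_iff_imp]
      intro h
      rcases Finset.mem_union.1 h with h | h
      · exact hA e h
      · exact (hmemE e).1 (Finset.mem_sdiff.1 (hF.1 h)).1
    have hdisj : Disjoint A F := by
      rw [Finset.disjoint_left]
      intro e h1 h2
      exact (Finset.mem_sdiff.1 (hF.1 h2)).2 (Finset.mem_union_left _ h1)
    rw [Finset.mem_filter, mem_gnmGraphs, edgeCount, hef _ rfl]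
    refine ⟨?_, Finset.subset_union_left, ?_⟩
    · rw [Finset.card_union_of_disjoint hdisj, hF.2]; omega
    · rw [Finset.disjoint_left]
      intro e h1 h2
      rcases Finset.mem_union.1 h2 with h | h
      · exact Finset.disjoint_left.1 hAB h h1
      · exact (Finset.mem_sdiff.1 (hF.1 h)).2 (Finset.mem_union_right _ h1)
  · intro G hG
    simp only [Finset.mem_filter] at hG
    have : A ∪ G.edgeFinset \ A = G.edgeFinset := Finset.union_sdiff_of_subset hG.2.1
    rw [this]
    simp
  · intro F hF
    rw [Finset.mem_powersetCard] at hF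
    ext e
    generalize hH : SimpleGraph.fromEdgeSet (↑(A ∪ F) : Set (Sym2 (Fin n))) = H
    rw [Finset.mem_sdiff, SimpleGraph.mem_edgeFinset, ← hH, SimpleGraph.edgeSet_fromEdgeSet]
    simp only [Set.mem_sdiff, Finset.mem_coe, Sym2.mem_diagSet, Finset.mem_union]
    constructor
    · tauto
    · intro h
      have := Finset.mem_sdiff.1 (hF.1 h)
      rw [hmemE, Finset.mem_union] at this
      tauto

lemma card_gnmGraphs (n M : ℕ) : (gnmGraphs n M).card = (n.choose 2).choose M := by
  have := card_gnmGraphs_filter_edges (n := n) (M := M) (A := ∅) (B := ∅)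
    (by simp) (by simp) (by simp) (by simp)
  simpa using this

/-- The graphs with `M` edges whose adjacencies among the pairs in `X` are exactly those in `T`. -/
lemma card_gnmGraphs_filter_trace {n M : ℕ} {X T : Finset (Fin n × Fin n)} (hT : T ⊆ X)
    (hX : ∀ p ∈ X, p.1 ≠ p.2) (hinj : Set.InjOn (fun p : Fin n × Fin n => s(p.1, p.2)) X)
    (hM : T.card ≤ M) :
    ((gnmGraphs n M).filter fun G => ∀ p ∈ X, (G.Adj p.1 p.2 ↔ p ∈ T)).card =
      (n.choose 2 - X.card).choose (M - T.card) := by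
  have hcT : (T.image fun p : Fin n × Fin n => s(p.1, p.2)).card = T.card :=
    Finset.card_image_of_injOn (hinj.mono (by exact_mod_cast hT))
  have hcX : ((X \ T).image fun p : Fin n × Fin n => s(p.1, p.2)).card = (X \ T).card :=
    Finset.card_image_of_injOn (hinj.mono (by exact_mod_cast Finset.sdiff_subset))
  have key := card_gnmGraphs_filter_edges (n := n) (M := M)
    (A := T.image fun p => s(p.1, p.2)) (B := (X \ T).image fun p => s(p.1, p.2)) ?_ ?_ ?_
    (by rw [hcT]; exact hM)
  · rw [hcT, hcX, Finset.card_sdiff_of_subset hT,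
      Nat.add_sub_cancel' (Finset.card_le_card hT)] at key
    rw [← key]
    congr 1
    apply Finset.filter_congr
    intro G _
    constructor
    · intro h
      constructor
      · intro e he
        obtain ⟨p, hp, rfl⟩ := Finset.mem_image.1 he
        rw [SimpleGraph.mem_edgeFinset, SimpleGraph.mem_edgeSet]
        exact (h p (hT hp)).2 hp
      · rw [Finset.disjoint_left]
        intro e he
        obtain ⟨p, hp, rfl⟩ := Finset.mem_image.1 he
        rw [Finset.mem_sdiff] at hp
        rw [SimpleGraph.mem_edgeFinset, SimpleGraph.mem_edgeSet]
        exact fun h' => hp.2 ((h p hp.1).1 h')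
    · rintro ⟨h1, h2⟩ p hp
      constructor
      · intro h
        by_contra hpT
        refine Finset.disjoint_left.1 h2
          (Finset.mem_image_of_mem _ (Finset.mem_sdiff.2 ⟨hp, hpT⟩)) ?_
        rwa [SimpleGraph.mem_edgeFinset, SimpleGraph.mem_edgeSet]
      · intro h
        have := h1 (Finset.mem_image_of_mem _ h)
        rwa [SimpleGraph.mem_edgeFinset, SimpleGraph.mem_edgeSet] at this
  · intro e he
    obtain ⟨p, hp, rfl⟩ := Finset.mem_image.1 he
    simpa using hX p (hT hp)
  · intro e he
    obtain ⟨p, hp, rfl⟩ := Finset.mem_image.1 he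
    simpa using hX p (Finset.mem_sdiff.1 hp).1
  · rw [Finset.disjoint_left]
    intro e he he'
    obtain ⟨p, hp, rfl⟩ := Finset.mem_image.1 he
    obtain ⟨q, hq, hpq⟩ := Finset.mem_image.1 he'
    rw [Finset.mem_sdiff] at hq
    have := hinj (by exact_mod_cast hq.1) (by exact_mod_cast hT hp) hpq
    exact hq.2 (this ▸ hp)

lemma gnmProb_eq (n M : ℕ) (A : Set (SimpleGraph (Fin n))) :
    gnmProb n M A =
      (((gnmGraphs n M).filter fun G => G ∈ A).card : ℝ) / ((n.choose 2).choose M : ℕ) := by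
  rw [← card_gnmGraphs, gnmProb, gnmGraphs, Finset.filter_filter]

/-- The probability that `a` given edges are present and `b` given edges are absent when `M` of
`N` edges are chosen uniformly. -/
noncomputable def patternProb (N M a b : ℕ) : ℝ :=
  ((N - (a + b)).choose (M - a) : ℝ) / (N.choose M : ℝ)

lemma choose_mul_descFactorial_eq {N M a b : ℕ} (ha : a ≤ M) (hM : M ≤ N) (hab : a + b ≤ N) :
    (N - (a + b)).choose (M - a) * N.descFactorial (a + b) =
      N.choose M * (M.descFactorial a * (N - M).descFactorial b) := by
  by_cases hb : b ≤ N - M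
  · have h1 := Nat.choose_mul_factorial_mul_factorial (n := N - (a + b)) (k := M - a) (by omega)
    have h2 := Nat.choose_mul_factorial_mul_factorial hM
    have h3 := Nat.factorial_mul_descFactorial hab
    have h4 := Nat.factorial_mul_descFactorial ha
    have h5 := Nat.factorial_mul_descFactorial hb
    have h6 : N - (a + b) - (M - a) = N - M - b := by omega
    rw [h6] at h1
    have hpos : 0 < (M - a).factorial * (N - M - b).factorial := by positivity
    apply Nat.eq_of_mul_eq_mul_right hpos
    calc _ = ((N - (a + b)).choose (M - a) * (M - a).factorial * (N - M - b).factorial) *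
          N.descFactorial (a + b) := by ring
      _ = N.choose M * ((M - a).factorial * M.descFactorial a) *
          ((N - M - b).factorial * (N - M).descFactorial b) := by rw [h1, h3, h4, h5, h2]
      _ = _ := by ring
  · rw [Nat.choose_eq_zero_of_lt (by omega), Nat.descFactorial_of_lt (n := N - M) (by omega)]
    simp

lemma patternProb_eq {N M a b : ℕ} (ha : a ≤ M) (hM : M ≤ N) (hab : a + b ≤ N) :
    patternProb N M a b = ((M.descFactorial a : ℝ) / N.descFactorial a) *
      ((N - M).descFactorial b / (N - a).descFactorial b) := by
  have h := choose_mul_descFactorial_eq ha hM hab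
  have h2 := Nat.descFactorial_mul_descFactorial (n := N) (k := a) (m := a + b) (by omega)
  rw [Nat.add_sub_cancel_left] at h2
  have p1 : 0 < N.descFactorial a := Nat.descFactorial_pos.2 (by omega)
  have p2 : 0 < (N - a).descFactorial b := Nat.descFactorial_pos.2 (by omega)
  have p3 : 0 < N.choose M := Nat.choose_pos hM
  rw [← h2] at h
  have h' : ((N - (a + b)).choose (M - a) : ℝ) * ((N - a).descFactorial b * N.descFactorial a) =
      N.choose M * (M.descFactorial a * (N - M).descFactorial b) := by exact_mod_cast h
  rw [patternProb, div_mul_div_comm, div_eq_div_iff (by positivity) (by positivity)]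
  linarith

lemma descFactorial_div_le_pow {A B b : ℕ} (hAB : A ≤ B) (hb : b ≤ B) :
    (A.descFactorial b : ℝ) / B.descFactorial b ≤ ((A : ℝ) / B) ^ b := by
  induction b with
  | zero => simp
  | succ b ih =>
    have hB : (b : ℝ) + 1 ≤ B := by exact_mod_cast hb
    have hA : (A : ℝ) ≤ B := by exact_mod_cast hAB
    rw [Nat.descFactorial_succ, Nat.descFactorial_succ, Nat.cast_mul, Nat.cast_mul,
      mul_div_mul_comm, pow_succ, mul_comm]
    apply mul_le_mul (ih (by omega)) _ (by positivity) (by positivity)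
    rw [Nat.cast_sub (by omega : b ≤ B)]
    rcases le_total b A with h | h
    · have hb0 : (0 : ℝ) ≤ b := b.cast_nonneg
      rw [Nat.cast_sub h, div_le_div_iff₀ (by linarith) (by linarith)]
      nlinarith
    · rw [Nat.sub_eq_zero_of_le h, Nat.cast_zero, zero_div]; positivity

lemma pow_le_descFactorial_div {A B b : ℕ} (hAB : A ≤ B) (hb : b ≤ A) (hbB : b < B) :
    (((A : ℝ) - b) / (B - b)) ^ b ≤ (A.descFactorial b : ℝ) / B.descFactorial b := by
  have key : ∀ i ≤ b, (((A : ℝ) - b) / (B - b)) ^ i ≤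
      (A.descFactorial i : ℝ) / B.descFactorial i := by
    have hB : (b : ℝ) + 1 ≤ B := by exact_mod_cast hbB
    have hA : (A : ℝ) ≤ B := by exact_mod_cast hAB
    have hbA : (b : ℝ) ≤ A := by exact_mod_cast hb
    intro i hi
    induction i with
    | zero => simp
    | succ i ih =>
      have hib : (i : ℝ) + 1 ≤ b := by exact_mod_cast hi
      rw [Nat.descFactorial_succ, Nat.descFactorial_succ, Nat.cast_mul, Nat.cast_mul,
        mul_div_mul_comm, pow_succ, mul_comm]
      apply mul_le_mul _ (ih (by omega)) (by apply pow_nonneg; apply div_nonneg <;> linarith)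
        (by positivity)
      rw [Nat.cast_sub (by omega : i ≤ B), Nat.cast_sub (by omega : i ≤ A),
        div_le_div_iff₀ (by linarith) (by linarith)]
      nlinarith
  exact key b le_rfl

lemma patternProb_le {N M a b : ℕ} (ha : a ≤ M) (hM : M ≤ N) (hab : a + b ≤ N) :
    patternProb N M a b ≤ ((M : ℝ) / N) ^ a * (((N : ℝ) - M) / (N - a)) ^ b := by
  rw [patternProb_eq ha hM hab]
  have h1 := descFactorial_div_le_pow (b := a) hM (by omega)
  have h2 := descFactorial_div_le_pow (A := N - M) (B := N - a) (b := b) (by omega) (by omega)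
  rw [Nat.cast_sub hM, Nat.cast_sub (by omega : a ≤ N)] at h2
  exact mul_le_mul h1 h2 (by positivity) (by positivity)

lemma le_patternProb {N M a b : ℕ} (ha : a ≤ M) (hM : M + b ≤ N) (hab : a + b < N) :
    (((M : ℝ) - a) / (N - a)) ^ a * (((N : ℝ) - M - b) / (N - a - b)) ^ b ≤
      patternProb N M a b := by
  rw [patternProb_eq ha (by omega) hab.le]
  have h1 := pow_le_descFactorial_div (A := M) (B := N) (b := a) (by omega) (by omega) (by omega)
  have h2 := pow_le_descFactorial_div (A := N - M) (B := N - a) (b := b)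
    (by omega) (by omega) (by omega)
  rw [Nat.cast_sub (by omega), Nat.cast_sub (by omega : a ≤ N)] at h2
  refine mul_le_mul h1 h2 (pow_nonneg (div_nonneg ?_ ?_) _) (by positivity)
  · have : (M : ℝ) + b ≤ N := by exact_mod_cast hM
    linarith
  · have : (a : ℝ) + b < N := by exact_mod_cast hab
    linarith

/-- Requiring one further edge costs a factor of at most `M / (N - c)`. -/
lemma patternProb_succ_le {N M a b c : ℕ} (ha : a + 1 ≤ M) (hM : M ≤ N) (hab : a + b ≤ c)
    (hc : c < N) :
    patternProb N M (a + 1) b ≤ patternProb N M a b * ((M : ℝ) / (N - c)) := by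
  have h := Nat.add_one_mul_choose_eq (N - (a + 1 + b)) (M - (a + 1))
  rw [show N - (a + 1 + b) + 1 = N - (a + b) by omega,
    show M - (a + 1) + 1 = M - a by omega] at h
  have h' : ((N : ℝ) - (a + b)) * ((N - (a + 1 + b)).choose (M - (a + 1)) : ℝ) =
      (N - (a + b)).choose (M - a) * ((M : ℝ) - a) := by
    have := congrArg (Nat.cast : ℕ → ℝ) h
    push_cast [Nat.cast_sub (by omega : a + b ≤ N), Nat.cast_sub (by omega : a ≤ M)] at this
    exact this
  have hcN : (c : ℝ) < N := by exact_mod_cast hc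
  have habc : (a : ℝ) + b ≤ c := by exact_mod_cast hab
  have p3 : (0 : ℝ) < N.choose M := by exact_mod_cast Nat.choose_pos hM
  unfold patternProb
  rw [div_mul_eq_mul_div]
  gcongr
  rw [← mul_div_assoc, le_div_iff₀ (by linarith)]
  have e1 : (0 : ℝ) ≤ (N - (a + 1 + b)).choose (M - (a + 1)) := by positivity
  have e2 : (0 : ℝ) ≤ (N - (a + b)).choose (M - a) := by positivity
  have e3 : (0 : ℝ) ≤ a := by positivity
  nlinarith

lemma le_vertexConnectivity_iff {n : ℕ} (hn : 0 < n) (G : SimpleGraph (Fin n)) (j : ℕ) :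
    j ≤ vertexConnectivity G ↔ j < n ∧ ∀ S : Finset (Fin n), S.card < j →
      (G.induce ((↑S : Set (Fin n))ᶜ)).Connected := by
  unfold vertexConnectivity
  set K := {k | k < Fintype.card (Fin n) ∧ ∀ S : Finset (Fin n), S.card < k →
    (G.induce ((↑S : Set (Fin n))ᶜ)).Connected} with hK
  have hbdd : BddAbove K := ⟨n, fun k hk => by simpa using hk.1.le⟩
  have hne : K.Nonempty := ⟨0, by simpa using hn, fun S hS => absurd hS (by simp)⟩
  constructor
  · intro h
    have hmem := Nat.sSup_mem hne hbdd
    exact ⟨h.trans_lt (by simpa using hmem.1), fun S hS => hmem.2 S (hS.trans_le h)⟩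
  · rintro ⟨h1, h2⟩
    exact le_csSup hbdd ⟨by simpa using h1, h2⟩

lemma le_degree_of_le_vertexConnectivity {n j : ℕ} {G : SimpleGraph (Fin n)}
    (h : j ≤ vertexConnectivity G) (v : Fin n) : j ≤ G.degree v := by
  have hn : 0 < n := v.pos
  obtain ⟨h1, h2⟩ := (le_vertexConnectivity_iff hn G j).1 h
  by_contra! hlt
  have hconn := h2 (G.neighborFinset v) (by rwa [SimpleGraph.card_neighborFinset_eq_degree])
  have hcard : (insert v (G.neighborFinset v)).card < Fintype.card (Fin n) := by
    refine (Finset.card_insert_le _ _).trans_lt ?_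
    rw [SimpleGraph.card_neighborFinset_eq_degree, Fintype.card_fin]
    omega
  obtain ⟨w, hw⟩ : ∃ w, w ∉ insert v (G.neighborFinset v) := by
    by_contra! hall
    rw [Finset.eq_univ_of_forall hall] at hcard
    simp at hcard
  rw [Finset.mem_insert, not_or] at hw
  set s : Set (Fin n) := (↑(G.neighborFinset v) : Set (Fin n))ᶜ
  have hv : v ∈ s := by simp [s]
  have hws : w ∈ s := by simpa [s] using hw.2
  have hne : (⟨v, hv⟩ : s) ≠ ⟨w, hws⟩ := fun h => hw.1 (congrArg Subtype.val h).symm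
  obtain ⟨p⟩ := hconn.preconnected ⟨v, hv⟩ ⟨w, hws⟩
  cases p with
  | nil => exact hne rfl
  | @cons _ x _ hadj _ =>
    have : G.Adj v x := hadj
    have hx := x.2
    simp [s] at hx
    exact hx this

/-- The graph has a set `C` of at most half of the vertices which spans an edge and whose outer
neighbourhood has fewer than `d` elements. -/
def HasSmallCut {n : ℕ} (d : ℕ) (G : SimpleGraph (Fin n)) : Prop :=
  ∃ C S : Finset (Fin n), Disjoint C S ∧ S.card < d ∧ 2 * C.card ≤ n ∧
    (∃ u ∈ C, ∃ w ∈ C, G.Adj u w) ∧ (∀ s ∈ S, ∃ c ∈ C, G.Adj s c) ∧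
    ∀ c ∈ C, ∀ v, v ∉ C → v ∉ S → ¬ G.Adj c v

lemma HasSmallCut.mono {n d d' : ℕ} (h : d ≤ d') {G : SimpleGraph (Fin n)}
    (hG : HasSmallCut d G) : HasSmallCut d' G := by
  obtain ⟨C, S, h1, h2, h3⟩ := hG
  exact ⟨C, S, h1, h2.trans_le h, h3⟩

lemma hasSmallCut_of_degree {n j : ℕ} {G : SimpleGraph (Fin n)} (hj : j < n)
    (hdeg : ∀ v, j ≤ G.degree v) (hκ : ¬ j ≤ vertexConnectivity G) : HasSmallCut j G := by
  rw [le_vertexConnectivity_iff (by omega), not_and] at hκ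
  have := hκ hj
  push Not at this
  obtain ⟨S, hS, hnc⟩ := this
  set s : Set (Fin n) := (↑S : Set (Fin n))ᶜ with hs
  have hmem : ∀ v, v ∈ s ↔ v ∉ S := by simp [hs]
  have hne : Nonempty s := by
    by_contra hcon
    rw [not_nonempty_iff] at hcon
    have : S = Finset.univ := Finset.eq_univ_of_forall fun v => by
      by_contra hv
      exact hcon.false ⟨v, (hmem v).2 hv⟩
    rw [this, Finset.card_univ, Fintype.card_fin] at hS
    omega
  have hnp : ¬ (G.induce s).Preconnected := fun h => hnc ⟨h⟩
  unfold SimpleGraph.Preconnected at hnp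
  push Not at hnp
  obtain ⟨a, b, hab⟩ := hnp
  let comp : s → Finset (Fin n) := fun a =>
    Finset.univ.filter fun v => ∃ h : v ∈ s, (G.induce s).Reachable a ⟨v, h⟩
  have hcomp : ∀ a v, v ∈ comp a ↔ ∃ h : v ∈ s, (G.induce s).Reachable a ⟨v, h⟩ := by
    intro a v; simp [comp]
  have hdisj : Disjoint (comp a) (comp b) := by
    rw [Finset.disjoint_left]
    intro v h1 h2
    obtain ⟨_, h1⟩ := (hcomp _ _).1 h1
    obtain ⟨_, h2⟩ := (hcomp _ _).1 h2
    exact hab (h1.trans h2.symm)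
  have hsmall : ∃ a : s, 2 * (comp a).card ≤ n := by
    have hle : (comp a ∪ comp b).card ≤ n := by
      simpa using Finset.card_le_univ (comp a ∪ comp b)
    rw [Finset.card_union_of_disjoint hdisj] at hle
    rcases le_total (comp a).card (comp b).card with h | h
    · exact ⟨a, by omega⟩
    · exact ⟨b, by omega⟩
  obtain ⟨a, ha⟩ := hsmall
  have hCS : Disjoint (comp a) S := by
    rw [Finset.disjoint_left]
    intro v h1
    obtain ⟨h, _⟩ := (hcomp _ _).1 h1
    exact (hmem v).1 h
  have hstep : ∀ c ∈ comp a, ∀ v, v ∉ S → G.Adj c v → v ∈ comp a := by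
    intro c hc v hv hadj
    obtain ⟨h, hr⟩ := (hcomp _ _).1 hc
    refine (hcomp _ _).2 ⟨(hmem v).2 hv, hr.trans ?_⟩
    apply SimpleGraph.Adj.reachable
    exact hadj
  refine ⟨comp a, S.filter fun s => ∃ c ∈ comp a, G.Adj s c,
    hCS.mono_right (Finset.filter_subset _ _),
    (Finset.card_le_card (Finset.filter_subset _ _)).trans_lt hS, ha, ?_,
    fun s hs => (Finset.mem_filter.1 hs).2, ?_⟩
  · have haC : (a : Fin n) ∈ comp a := (hcomp _ _).2 ⟨a.2, SimpleGraph.Reachable.refl _⟩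
    have hlt : S.card < (G.neighborFinset a).card := by
      rw [SimpleGraph.card_neighborFinset_eq_degree]
      exact hS.trans_le (hdeg a)
    obtain ⟨w, hw, hwS⟩ := Finset.exists_mem_notMem_of_card_lt_card hlt
    rw [SimpleGraph.mem_neighborFinset] at hw
    exact ⟨a, haC, w, hstep a haC w hwS hw, hw⟩
  · intro c hc v hvC hvS hadj
    by_cases hv : v ∈ S
    · exact hvS (Finset.mem_filter.2 ⟨hv, c, hc, hadj.symm⟩)
    · exact hvC (hstep c hc v hv hadj)

lemma card_filter_cut_witness_le {n M : ℕ} {C S : Finset (Fin n)} (hCS : Disjoint C S)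
    {u w : Fin n} (hu : u ∈ C) (hw : w ∈ C) (huw : u ≠ w) (φ : S → C) (hM : S.card + 1 ≤ M) :
    ((gnmGraphs n M).filter fun G => G.Adj u w ∧ (∀ s : S, G.Adj s (φ s)) ∧
      ∀ c ∈ C, ∀ v, v ∉ C → v ∉ S → ¬ G.Adj c v).card ≤
    (n.choose 2 - (S.card + 1 + C.card * (n - C.card - S.card))).choose (M - (S.card + 1)) := by
  set T₀ : Finset (Fin n × Fin n) :=
    Finset.image (fun s : S => ((s : Fin n), (φ s : Fin n))) Finset.univ with hT₀
  have hmemT₀ : ∀ p, p ∈ T₀ ↔ ∃ s : S, ((s : Fin n), (φ s : Fin n)) = p := by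
    intro p; simp [hT₀]
  have hCS' : ∀ x ∈ C, x ∉ S := fun x hx => Finset.disjoint_left.1 hCS hx
  set T : Finset (Fin n × Fin n) := insert (u, w) T₀ with hT
  set Y : Finset (Fin n × Fin n) := C ×ˢ (C ∪ S)ᶜ with hY
  have hmemY : ∀ p, p ∈ Y ↔ p.1 ∈ C ∧ p.2 ∉ C ∧ p.2 ∉ S := by
    intro p; simp [hY]
  have hTsnd : ∀ p ∈ T, p.2 ∈ C := by
    intro p hp
    rcases Finset.mem_insert.1 hp with rfl | h
    · exact hw
    · obtain ⟨s, rfl⟩ := (hmemT₀ p).1 h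
      exact (φ s).2
  have hTcases : ∀ p ∈ T, p = (u, w) ∨ ∃ s : S, ((s : Fin n), (φ s : Fin n)) = p := by
    intro p hp
    rcases Finset.mem_insert.1 hp with h | h
    · exact Or.inl h
    · exact Or.inr ((hmemT₀ p).1 h)
  have hcT : T.card = S.card + 1 := by
    rw [hT, Finset.card_insert_of_notMem, hT₀, Finset.card_image_of_injective]
    · simp
    · intro s s' h
      exact Subtype.ext (Prod.ext_iff.1 h).1
    · intro h
      obtain ⟨s, hs⟩ := (hmemT₀ _).1 h
      have hsu : (s : Fin n) = u := (Prod.ext_iff.1 hs).1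
      exact hCS' u hu (hsu ▸ s.2)
  have hTY : Disjoint T Y := by
    rw [Finset.disjoint_left]
    intro p h1 h2
    exact ((hmemY p).1 h2).2.1 (hTsnd p h1)
  have hcY : Y.card = C.card * (n - C.card - S.card) := by
    rw [hY, Finset.card_product, Finset.card_compl, Finset.card_union_of_disjoint hCS,
      Fintype.card_fin, Nat.sub_sub]
  have key := card_gnmGraphs_filter_trace (n := n) (M := M) (X := T ∪ Y) (T := T)
    Finset.subset_union_left ?_ ?_ (by omega)
  · rw [Finset.card_union_of_disjoint hTY, hcT, hcY] at key
    rw [← key]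
    apply Finset.card_le_card
    intro G hG
    rw [Finset.mem_filter] at hG ⊢
    obtain ⟨h0, h1, h2, h3⟩ := hG
    refine ⟨h0, fun p hp => ?_⟩
    rcases Finset.mem_union.1 hp with hp | hp
    · refine iff_of_true ?_ hp
      rcases hTcases p hp with rfl | ⟨s, rfl⟩
      · exact h1
      · exact h2 s
    · refine iff_of_false ?_ fun h => Finset.disjoint_left.1 hTY h hp
      obtain ⟨a, b, c⟩ := (hmemY p).1 hp
      exact h3 _ a _ b c
  · intro p hp
    rcases Finset.mem_union.1 hp with hp | hp
    · rcases hTcases p hp with rfl | ⟨s, rfl⟩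
      · exact huw
      · intro h
        dsimp only at h
        exact hCS' _ (φ s).2 (h ▸ s.2)
    · obtain ⟨a, b, c⟩ := (hmemY p).1 hp
      intro h
      exact b (h ▸ a)
  · have main : ∀ p ∈ T ∪ Y, ∀ q ∈ T ∪ Y, p.1 = q.2 → p.2 = q.1 → p = q := by
      intro p hp q hq h1 h2
      exfalso
      have hout : ∀ r ∈ T ∪ Y, ∀ r' ∈ T ∪ Y, r.1 = r'.2 → r.2 = r'.1 → r ∉ Y := by
        intro r hr r' hr' h1 h2 h
        obtain ⟨a, b, c⟩ := (hmemY r).1 h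
        rcases Finset.mem_union.1 hr' with h' | h'
        · rcases hTcases r' h' with rfl | ⟨s, rfl⟩
          · exact b (h2 ▸ hu)
          · exact c (h2 ▸ s.2)
        · exact b (h2 ▸ ((hmemY r').1 h').1)
      have hpT : p ∈ T := (Finset.mem_union.1 hp).resolve_right (hout p hp q hq h1 h2)
      have hqT : q ∈ T := (Finset.mem_union.1 hq).resolve_right (hout q hq p hp h2.symm h1.symm)
      have hp2 := hTsnd p hpT
      have hq2 := hTsnd q hqT
      rcases hTcases p hpT with rfl | ⟨s, rfl⟩
      · rcases hTcases q hqT with rfl | ⟨s', rfl⟩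
        · exact huw h1
        · exact hCS' _ hp2 (h2 ▸ s'.2)
      · exact hCS' _ hq2 (h1 ▸ s.2)
    intro p hp q hq hpq
    have hp' := Finset.mem_coe.1 hp
    have hq' := Finset.mem_coe.1 hq
    rcases Sym2.eq_iff.1 hpq with ⟨h1, h2⟩ | ⟨h1, h2⟩
    · exact Prod.ext h1 h2
    · exact main p hp' q hq' h1 h2

lemma gnmProb_hasSmallCut_le {n M k : ℕ} (hM : k + 1 ≤ M) :
    gnmProb n M {G | HasSmallCut (k + 1) G} ≤
      ∑ C ∈ Finset.univ.filter (fun C : Finset (Fin n) => 2 ≤ C.card ∧ 2 * C.card ≤ n),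
        ∑ S ∈ Finset.univ.filter (fun S : Finset (Fin n) => S.card ≤ k),
          (C.card : ℝ) ^ (S.card + 2) *
            patternProb (n.choose 2) M (S.card + 1) (C.card * (n - C.card - S.card)) := by
  let W : Finset (Fin n) → Finset (Fin n) → ℕ := fun C S =>
    (n.choose 2 - (S.card + 1 + C.card * (n - C.card - S.card))).choose (M - (S.card + 1))
  have hcount : ((gnmGraphs n M).filter fun G => HasSmallCut (k + 1) G).card ≤
      ∑ C ∈ Finset.univ.filter (fun C : Finset (Fin n) => 2 ≤ C.card ∧ 2 * C.card ≤ n),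
        ∑ S ∈ Finset.univ.filter (fun S : Finset (Fin n) => S.card ≤ k),
          C.card ^ (S.card + 2) * W C S := by
    let F : (C S : Finset (Fin n)) → (Fin n × Fin n) → (S → C) → Finset (SimpleGraph (Fin n)) :=
      fun C S p φ => if Disjoint C S ∧ p.1 ≠ p.2 then
        (gnmGraphs n M).filter fun G => G.Adj p.1 p.2 ∧ (∀ s : S, G.Adj s (φ s)) ∧
          ∀ c ∈ C, ∀ v, v ∉ C → v ∉ S → ¬ G.Adj c v else ∅
    have hsub : ((gnmGraphs n M).filter fun G => HasSmallCut (k + 1) G) ⊆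
        (Finset.univ.filter (fun C : Finset (Fin n) => 2 ≤ C.card ∧ 2 * C.card ≤ n)).biUnion
          fun C => (Finset.univ.filter (fun S : Finset (Fin n) => S.card ≤ k)).biUnion
            fun S => (C ×ˢ C).biUnion fun p => Finset.univ.biUnion fun φ => F C S p φ := by
      intro G hG
      rw [Finset.mem_filter] at hG
      obtain ⟨hG, C, S, hCS, hS, hC, ⟨u, hu, w, hw, huw⟩, hφ, hno⟩ := hG
      have h2 : 2 ≤ C.card := Finset.one_lt_card.2 ⟨u, hu, w, hw, huw.ne⟩
      choose f hf hadj using hφ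
      simp only [Finset.mem_biUnion, Finset.mem_filter, Finset.mem_univ, true_and]
      refine ⟨C, ⟨h2, hC⟩, S, by omega, (u, w), Finset.mk_mem_product hu hw,
        fun s => ⟨f s s.2, hf s s.2⟩, ?_⟩
      simp only [F]
      rw [if_pos ⟨hCS, huw.ne⟩, Finset.mem_filter]
      exact ⟨hG, huw, fun s => hadj s s.2, hno⟩
    refine (Finset.card_le_card hsub).trans (Finset.card_biUnion_le.trans ?_)
    refine Finset.sum_le_sum fun C hC => Finset.card_biUnion_le.trans ?_
    refine Finset.sum_le_sum fun S hS => Finset.card_biUnion_le.trans ?_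
    have hSk : S.card ≤ k := (Finset.mem_filter.1 hS).2
    have hF : ∀ p ∈ C ×ˢ C, ∀ φ : S → C, (F C S p φ).card ≤ W C S := by
      intro p hp φ
      simp only [F]
      split_ifs with h
      · rw [Finset.mem_product] at hp
        exact card_filter_cut_witness_le h.1 hp.1 hp.2 h.2 φ (by omega)
      · simp
    calc ∑ p ∈ C ×ˢ C, (Finset.univ.biUnion fun φ => F C S p φ).card
        ≤ ∑ p ∈ C ×ˢ C, C.card ^ S.card * W C S := by
          refine Finset.sum_le_sum fun p hp => Finset.card_biUnion_le.trans ?_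
          refine (Finset.sum_le_sum fun φ _ => hF p hp φ).trans ?_
          simp
      _ = C.card ^ (S.card + 2) * W C S := by
          rw [Finset.sum_const, Finset.card_product, smul_eq_mul]; ring
  rw [gnmProb_eq]
  calc _ ≤ ((∑ C ∈ Finset.univ.filter (fun C : Finset (Fin n) => 2 ≤ C.card ∧ 2 * C.card ≤ n),
        ∑ S ∈ Finset.univ.filter (fun S : Finset (Fin n) => S.card ≤ k),
          C.card ^ (S.card + 2) * W C S : ℕ) : ℝ) / ((n.choose 2).choose M : ℕ) := by
        gcongr
        exact_mod_cast hcount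
    _ = _ := by
        push_cast
        simp_rw [Finset.sum_div, mul_div_assoc]
        rfl

lemma sum_powerset_filter_card_le {α : Type*} (A : Finset α) (k : ℕ) (g : ℕ → ℝ) :
    ∑ S ∈ A.powerset.filter (fun S => S.card ≤ k), g S.card =
      ∑ s ∈ Finset.range (k + 1), (A.card.choose s : ℝ) * g s := by
  rw [← Finset.sum_fiberwise_of_maps_to (t := Finset.range (k + 1)) (g := Finset.card)
    (fun S hS => Finset.mem_range.2 (Nat.lt_succ_of_le (Finset.mem_filter.1 hS).2))]
  refine Finset.sum_congr rfl fun s hs => ?_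
  rw [← Finset.card_powersetCard, ← nsmul_eq_mul, ← Finset.sum_const]
  have : (A.powerset.filter (fun S => S.card ≤ k)).filter (fun S => S.card = s) =
      Finset.powersetCard s A := by
    ext S
    simp only [Finset.mem_filter, Finset.mem_powerset, Finset.mem_powersetCard]
    have := Finset.mem_range.1 hs
    constructor
    · rintro ⟨⟨h1, -⟩, h2⟩; exact ⟨h1, h2⟩
    · rintro ⟨h1, h2⟩; exact ⟨⟨h1, by omega⟩, h2⟩
  rw [this]
  exact Finset.sum_congr rfl fun S hS => by rw [(Finset.mem_powersetCard.1 hS).2]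

lemma choose_mul_exp_le {n t k : ℕ} {ξ c : ℝ} (hn : 0 < n) (ht : 1 ≤ t) (h2t : 2 * t ≤ n)
    (hk : 4 * k ≤ n) (hξ0 : 0 ≤ ξ) (hξ : Real.log n - c ≤ ξ)
    (hbig : Real.exp 1 * ((1 + k) * ξ) * Real.exp (-(ξ / 4)) ≤ 1 / 2) :
    (n.choose t : ℝ) * Real.exp (-(ξ * t * (n - t - k) / n)) ≤
      Real.exp (c + 1) ^ t / t.factorial + (1 / 2) ^ t := by
  have hn' : (0 : ℝ) < n := by exact_mod_cast hn
  have ht' : (1 : ℝ) ≤ t := by exact_mod_cast ht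
  have h2t' : 2 * (t : ℝ) ≤ n := by exact_mod_cast h2t
  have hk' : 4 * (k : ℝ) ≤ n := by exact_mod_cast hk
  have hk0 : (0 : ℝ) ≤ k := k.cast_nonneg
  have hchoose : (n.choose t : ℝ) ≤ (n : ℝ) ^ t / t.factorial := Nat.choose_le_pow_div t n
  by_cases hcase : ξ * (t + k) ≤ n
  · have h1 : Real.exp (-(ξ * t * (n - t - k) / n)) ≤ (Real.exp (c + 1) / n) ^ t := by
      have : Real.exp (c + 1) / n = Real.exp (c + 1 - Real.log n) := by
        rw [Real.exp_sub, Real.exp_log hn']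
      rw [this, ← Real.exp_nat_mul, Real.exp_le_exp]
      have e1 : -(ξ * t * (n - t - k) / n) = -(ξ * t) + t * (ξ * (t + k) / n) := by
        field_simp; ring
      have e2 : ξ * (t + k) / n ≤ 1 := by rwa [div_le_one hn']
      rw [e1]
      nlinarith
    calc (n.choose t : ℝ) * Real.exp (-(ξ * t * (n - t - k) / n))
        ≤ ((n : ℝ) ^ t / t.factorial) * (Real.exp (c + 1) / n) ^ t := by gcongr
      _ = Real.exp (c + 1) ^ t / t.factorial := by
        rw [div_pow]; field_simp
      _ ≤ _ := by
        have : (0 : ℝ) ≤ (1 / 2) ^ t := by positivity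
        linarith
  · push Not at hcase
    have h1 : Real.exp (-(ξ * t * (n - t - k) / n)) ≤ Real.exp (-(ξ / 4)) ^ t := by
      rw [← Real.exp_nat_mul, Real.exp_le_exp]
      have : ξ * t * (1 / 4) ≤ ξ * t * (n - t - k) / n := by
        rw [le_div_iff₀ hn', mul_assoc (ξ * t)]
        apply mul_le_mul_of_nonneg_left _ (by positivity)
        linarith
      linarith
    have hfac : (n : ℝ) ^ t / t.factorial ≤ (Real.exp 1 * ((1 + k) * ξ)) ^ t := by
      have hnt : (n : ℝ) ≤ (1 + k) * ξ * t := by nlinarith [mul_nonneg hξ0 hk0]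
      have hexp := Real.pow_div_factorial_le_exp (x := t) (by positivity) t
      calc (n : ℝ) ^ t / t.factorial ≤ ((1 + k) * ξ * t) ^ t / t.factorial := by gcongr
        _ = ((1 + k) * ξ) ^ t * ((t : ℝ) ^ t / t.factorial) := by rw [mul_pow]; ring
        _ ≤ ((1 + k) * ξ) ^ t * Real.exp t := by gcongr
        _ = _ := by rw [mul_pow (Real.exp 1), ← Real.exp_nat_mul, mul_one]; ring
    calc (n.choose t : ℝ) * Real.exp (-(ξ * t * (n - t - k) / n))
        ≤ (Real.exp 1 * ((1 + k) * ξ)) ^ t * Real.exp (-(ξ / 4)) ^ t := by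
          gcongr
          exact hchoose.trans hfac
      _ ≤ (1 / 2) ^ t := by
          rw [← mul_pow]
          gcongr
      _ ≤ _ := by
        have : (0 : ℝ) ≤ Real.exp (c + 1) ^ t / t.factorial := by positivity
        linarith

lemma patternProb_cut_le {n M k s t : ℕ} (hk : 2 * k ≤ n) (hkM : k + 1 ≤ M)
    (hM : M < n.choose 2) (ht : 2 ≤ t) (h2t : 2 * t ≤ n) (hs : s ≤ k) :
    patternProb (n.choose 2) M (s + 1) (t * (n - t - s)) ≤
      ((M : ℝ) / n.choose 2) ^ (s + 1) *
        Real.exp (-(((M : ℝ) - (k + 1)) / n.choose 2 * (t * (n - t - k)))) := by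
  obtain ⟨m, rfl⟩ : ∃ m, n = t + s + m := ⟨n - t - s, by omega⟩
  have hm : t + s + m - t - s = m := by omega
  have hN2 : 2 * (t + s + m).choose 2 = (t + s + m) * (t + s + m - 1) := by
    rw [Nat.choose_two_right]
    exact Nat.mul_div_cancel' (Nat.even_mul_pred_self _).two_dvd
  have hab : s + 1 + t * m ≤ (t + s + m).choose 2 := by
    obtain ⟨q, rfl⟩ : ∃ q, t = q + 2 := ⟨t - 2, by omega⟩
    have : q + 2 + s + m - 1 = q + 1 + s + m := by omega
    rw [this] at hN2
    nlinarith [Nat.zero_le (q * s), Nat.zero_le (q * m), Nat.zero_le (s * m), Nat.zero_le (s * s),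
      Nat.zero_le (m * m), Nat.zero_le (q * q), Nat.zero_le (s * (s - 1))]
  rw [hm]
  generalize (t + s + m).choose 2 = N at *
  refine (patternProb_le (by omega) hM.le hab).trans ?_
  apply mul_le_mul_of_nonneg_left _ (by positivity)
  have hkM' : (k : ℝ) + 1 ≤ M := by exact_mod_cast hkM
  have hsk : (s : ℝ) ≤ k := by exact_mod_cast hs
  have hMN : (M : ℝ) + 1 ≤ N := by exact_mod_cast hM
  have hs0 : (0 : ℝ) ≤ s := s.cast_nonneg
  have hNs : (0 : ℝ) < N - (s + 1 : ℕ) := by push_cast; linarith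
  have hbase : ((N : ℝ) - M) / (N - (s + 1 : ℕ)) ≤
      Real.exp (-(((M : ℝ) - (k + 1)) / N)) := by
    have h1 : ((N : ℝ) - M) / (N - (s + 1 : ℕ)) = 1 - ((M : ℝ) - (s + 1 : ℕ)) / (N - (s + 1 : ℕ)) := by
      field_simp; ring
    have h2 : ((M : ℝ) - (k + 1)) / N ≤ ((M : ℝ) - (s + 1 : ℕ)) / (N - (s + 1 : ℕ)) := by
      apply div_le_div₀ <;> push_cast <;> linarith
    have h3 := Real.add_one_le_exp (-(((M : ℝ) - (k + 1)) / N))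
    linarith
  have hbase0 : 0 ≤ ((N : ℝ) - M) / (N - (s + 1 : ℕ)) := div_nonneg (by linarith) hNs.le
  refine (pow_le_pow_left₀ hbase0 hbase _).trans ?_
  rw [← Real.exp_nat_mul, Real.exp_le_exp]
  push_cast
  have h4 : 0 ≤ ((M : ℝ) - (k + 1)) / N := div_nonneg (by linarith) (by linarith)
  have ht0 : (0 : ℝ) ≤ t := t.cast_nonneg
  have h5 : (t : ℝ) * (t + s + m - t - k) ≤ t * m :=
    mul_le_mul_of_nonneg_left (by linarith) ht0
  nlinarith

/-- A union bound for the probability of a small cut, in terms of the mean degree `x`. -/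
lemma gnmProb_hasSmallCut_le_sum {n M k : ℕ} {x ξ c : ℝ} (hx : (M : ℝ) = n / 2 * x)
    (hx1 : 1 ≤ x) (hn2 : 2 ≤ n) (hk : 4 * k ≤ n) (hkM : k + 1 ≤ M) (hM : M < n.choose 2)
    (hξ : ξ = n * (((M : ℝ) - (k + 1)) / n.choose 2)) (hlog : Real.log n - c ≤ ξ)
    (hbig : Real.exp 1 * ((1 + k) * ξ) * Real.exp (-(ξ / 4)) ≤ 1 / 2) :
    gnmProb n M {G | HasSmallCut (k + 1) G} ≤
      (k + 1) * ((2 * x) ^ (k + 1) / n) * ∑ t ∈ Finset.range (n + 1),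
        (t : ℝ) ^ (k + 2) * (Real.exp (c + 1) ^ t / t.factorial + (1 / 2) ^ t) := by
  have hn' : (2 : ℝ) ≤ n := by exact_mod_cast hn2
  have hN : (n.choose 2 : ℝ) = n * (n - 1) / 2 := Nat.cast_choose_two ℝ n
  have hNpos : (0 : ℝ) < n.choose 2 := by rw [hN]; nlinarith
  have hkM' : (k : ℝ) + 1 ≤ M := by exact_mod_cast hkM
  have hMN : (M : ℝ) / n.choose 2 ≤ 2 * x / n := by
    rw [hx, hN, div_le_div_iff₀ (by nlinarith) (by linarith)]
    nlinarith [mul_nonneg (mul_nonneg (by linarith : (0 : ℝ) ≤ n) (by linarith : (0 : ℝ) ≤ n - 2))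
      (by linarith : (0 : ℝ) ≤ x)]
  have hξ0 : 0 ≤ ξ := by
    rw [hξ]
    exact mul_nonneg (by linarith) (div_nonneg (by linarith) hNpos.le)
  have hinner : ∀ C ∈ Finset.univ.filter
      (fun C : Finset (Fin n) => 2 ≤ C.card ∧ 2 * C.card ≤ n),
      ∑ S ∈ Finset.univ.filter (fun S : Finset (Fin n) => S.card ≤ k),
          (C.card : ℝ) ^ (S.card + 2) *
            patternProb (n.choose 2) M (S.card + 1) (C.card * (n - C.card - S.card)) ≤
        (k + 1) * ((2 * x) ^ (k + 1) / n) * ((C.card : ℝ) ^ (k + 2) *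
          Real.exp (-(ξ * C.card * (n - C.card - k) / n))) := by
    intro C hC
    obtain ⟨hC2, hCn⟩ := (Finset.mem_filter.1 hC).2
    set t := C.card
    have ht1 : (1 : ℝ) ≤ t := by exact_mod_cast (by omega : 1 ≤ t)
    set E := Real.exp (-(ξ * t * (n - t - k) / n)) with hE
    have hE' : Real.exp (-(((M : ℝ) - (k + 1)) / n.choose 2 * (t * (n - t - k)))) = E := by
      rw [hE, hξ]
      congr 2
      field_simp
    set z : ℝ := t * (2 * x / n)
    have hz : 0 ≤ z := by positivity
    have hstep : ∀ S ∈ Finset.univ.filter (fun S : Finset (Fin n) => S.card ≤ k),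
        (t : ℝ) ^ (S.card + 2) *
          patternProb (n.choose 2) M (S.card + 1) (t * (n - t - S.card)) ≤
        (t : ℝ) ^ 2 * (2 * x / n) * E * z ^ S.card := by
      intro S hS
      have h := patternProb_cut_le (by omega : 2 * k ≤ n) hkM hM hC2 hCn (Finset.mem_filter.1 hS).2
      rw [hE'] at h
      calc _ ≤ (t : ℝ) ^ (S.card + 2) * (((M : ℝ) / n.choose 2) ^ (S.card + 1) * E) := by gcongr
        _ ≤ (t : ℝ) ^ (S.card + 2) * ((2 * x / n) ^ (S.card + 1) * E) := by gcongr
        _ = _ := by simp only [z, mul_pow]; ring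
    refine (Finset.sum_le_sum hstep).trans ?_
    rw [← Finset.mul_sum]
    have hsum : ∑ S ∈ Finset.univ.filter (fun S : Finset (Fin n) => S.card ≤ k), z ^ S.card ≤
        (k + 1) * (2 * x * t) ^ k := by
      rw [← Finset.powerset_univ, sum_powerset_filter_card_le _ k (fun s => z ^ s)]
      have : ∀ s ∈ Finset.range (k + 1),
          ((Finset.univ : Finset (Fin n)).card.choose s : ℝ) * z ^ s ≤ (2 * x * t) ^ k := by
        intro s hs
        have hs' := Finset.mem_range.1 hs
        rw [Finset.card_univ, Fintype.card_fin]
        have h1 : (n.choose s : ℝ) ≤ (n : ℝ) ^ s := by exact_mod_cast Nat.choose_le_pow n s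
        calc (n.choose s : ℝ) * z ^ s ≤ (n : ℝ) ^ s * z ^ s := by gcongr
          _ = (2 * x * t) ^ s := by
            rw [← mul_pow]; congr 1; simp only [z]; field_simp
          _ ≤ (2 * x * t) ^ k := pow_le_pow_right₀ (by nlinarith) (by omega)
      refine (Finset.sum_le_sum this).trans ?_
      simp
    calc _ ≤ (t : ℝ) ^ 2 * (2 * x / n) * E * ((k + 1) * (2 * x * t) ^ k) := by gcongr
      _ = _ := by rw [mul_pow (2 * x) (t : ℝ)]; ring
  refine (gnmProb_hasSmallCut_le hkM).trans ((Finset.sum_le_sum hinner).trans ?_)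
  rw [← Finset.mul_sum]
  apply mul_le_mul_of_nonneg_left _ (by positivity)
  let f : ℕ → ℝ := fun t => if 2 ≤ t ∧ 2 * t ≤ n then
    (t : ℝ) ^ (k + 2) * Real.exp (-(ξ * t * (n - t - k) / n)) else 0
  have hcard := Finset.sum_powerset_apply_card f (x := (Finset.univ : Finset (Fin n)))
  rw [Finset.powerset_univ, Finset.card_univ, Fintype.card_fin] at hcard
  rw [Finset.sum_filter]
  refine hcard.le.trans (Finset.sum_le_sum fun t _ => ?_)
  simp only [f, nsmul_eq_mul]
  split_ifs with h
  · have := choose_mul_exp_le (k := k) (by omega) (by omega) h.2 hk hξ0 hlog hbig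
    calc _ = (t : ℝ) ^ (k + 2) *
          ((n.choose t : ℝ) * Real.exp (-(ξ * t * (n - t - k) / n))) := by ring
      _ ≤ _ := by gcongr
  · rw [mul_zero]; positivity

lemma summable_pow_mul_pow_div_factorial_add (k : ℕ) (K : ℝ) :
    Summable fun t : ℕ => (t : ℝ) ^ k * (Real.exp K ^ t / t.factorial + (1 / 2) ^ t) := by
  simp_rw [mul_add]
  apply Summable.add
  · have h := (Real.summable_pow_div_factorial (Real.exp (K + 1))).mul_left (k.factorial : ℝ)
    refine Summable.of_nonneg_of_le (fun t => by positivity) (fun t => ?_) h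
    have h1 := Real.pow_div_factorial_le_exp (x := t) (by positivity) k
    rw [div_le_iff₀ (by positivity)] at h1
    calc (t : ℝ) ^ k * (Real.exp K ^ t / t.factorial)
        ≤ (Real.exp t * k.factorial) * (Real.exp K ^ t / t.factorial) := by gcongr
      _ = _ := by
        rw [Real.exp_add, mul_pow, ← Real.exp_nat_mul 1 t, mul_one]; ring
  · exact summable_pow_mul_geometric_of_norm_lt_one k (by norm_num)

theorem tendsto_gnmProb_hasSmallCut (k : ℕ) {M : ℕ → ℕ} {x : ℕ → ℝ} {c : ℝ}
    (hM : ∀ n : ℕ, (M n : ℝ) = n / 2 * x n) (hx : Tendsto x atTop atTop)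
    (hpow : ∀ j : ℕ, Tendsto (fun n : ℕ => x n ^ j / n) atTop (nhds 0))
    (hlog : ∀ᶠ n : ℕ in atTop, Real.log n - c ≤ x n) :
    Tendsto (fun n => gnmProb n (M n) {G | HasSmallCut (k + 1) G}) atTop (nhds 0) := by
  set ξ : ℕ → ℝ := fun n => n * (((M n : ℝ) - (k + 1)) / n.choose 2) with hξ
  have hcast : Tendsto (fun n : ℕ => (n : ℝ)) atTop atTop := tendsto_natCast_atTop_atTop
  have hξx : ∀ᶠ n : ℕ in atTop, x n - 2 * (k + 1) ≤ ξ n := by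
    filter_upwards [eventually_ge_atTop 2, hx.eventually_ge_atTop 0] with n hn hx0
    have hn' : (2 : ℝ) ≤ n := by exact_mod_cast hn
    simp only [hξ]
    rw [Nat.cast_choose_two, hM n, mul_div_assoc', le_div_iff₀ (by nlinarith)]
    have hk0 : (0 : ℝ) ≤ k := k.cast_nonneg
    nlinarith [mul_nonneg (by linarith : (0 : ℝ) ≤ n) hx0,
      mul_nonneg (by linarith : (0 : ℝ) ≤ n) (by linarith : (0 : ℝ) ≤ n - 2),
      mul_nonneg hk0 (mul_nonneg (by linarith : (0 : ℝ) ≤ n) (by linarith : (0 : ℝ) ≤ n - 2))]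
  have hξtop : Tendsto ξ atTop atTop :=
    tendsto_atTop_mono' _ hξx (tendsto_atTop_add_const_right _ (-(2 * ((k : ℝ) + 1))) hx)
  have hbig : ∀ᶠ n in atTop,
      Real.exp 1 * ((1 + k) * ξ n) * Real.exp (-(ξ n / 4)) ≤ 1 / 2 := by
    have h1 : Tendsto (fun u : ℝ => u ^ 1 * Real.exp (-u)) atTop (nhds 0) :=
      Real.tendsto_pow_mul_exp_neg_atTop_nhds_zero 1
    have h2 : Tendsto (fun n => ξ n / 4) atTop atTop := hξtop.atTop_div_const (by norm_num)
    have h3 := (h1.comp h2).const_mul (Real.exp 1 * (1 + k) * 4)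
    rw [mul_zero] at h3
    filter_upwards [h3.eventually_le_const (show (0 : ℝ) < 1 / 2 by norm_num)] with n hn
    refine le_trans (le_of_eq ?_) hn
    simp only [Function.comp]
    ring
  have hsmall : ∀ᶠ n in atTop, M n < n.choose 2 := by
    have h1 := (hpow 1).eventually_lt_const (show (0 : ℝ) < 1 / 4 by norm_num)
    filter_upwards [h1, eventually_ge_atTop 4] with n h1 h4
    have hn' : (4 : ℝ) ≤ n := by exact_mod_cast h4
    rw [pow_one, div_lt_iff₀ (by linarith)] at h1
    have : (M n : ℝ) < n.choose 2 := by
      rw [hM, Nat.cast_choose_two]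
      nlinarith
    exact_mod_cast this
  have hMtop : ∀ᶠ n in atTop, k + 1 ≤ M n := by
    filter_upwards [hx.eventually_ge_atTop (2 * (k + 1)), eventually_ge_atTop 1] with n h1 h2
    have hn' : (1 : ℝ) ≤ n := by exact_mod_cast h2
    have : (k : ℝ) + 1 ≤ M n := by
      rw [hM]
      have hk0 : (0 : ℝ) ≤ k := k.cast_nonneg
      nlinarith
    exact_mod_cast this
  set A : ℝ := ∑' t : ℕ, (t : ℝ) ^ (k + 2) *
    (Real.exp (c + 2 * (k + 1) + 1) ^ t / t.factorial + (1 / 2) ^ t) with hA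
  have hlim : Tendsto (fun n => (k + 1) * ((2 * x n) ^ (k + 1) / n) * A) atTop (nhds 0) := by
    have := (((hpow (k + 1)).const_mul ((2 : ℝ) ^ (k + 1))).const_mul ((k : ℝ) + 1)).mul_const A
    simp only [mul_zero, zero_mul] at this
    refine this.congr fun n => ?_
    rw [mul_pow]; ring
  refine squeeze_zero' (Eventually.of_forall fun n => by unfold gnmProb; positivity) ?_ hlim
  filter_upwards [hξx, hbig, hsmall, hMtop, hlog, hx.eventually_ge_atTop 1,
    eventually_ge_atTop 2, eventually_ge_atTop (4 * k)] with n h1 h2 h3 h4 h5 h6 h7 h8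
  refine (gnmProb_hasSmallCut_le_sum (c := c + 2 * (k + 1)) (hM n) h6 h7 h8 h4 h3 rfl
    (by linarith) h2).trans ?_
  apply mul_le_mul_of_nonneg_left _ (by positivity)
  exact (summable_pow_mul_pow_div_factorial_add (k + 2) _).sum_le_tsum _
    (fun t _ => by positivity)

/-- The vertices of degree at most `d`. -/
noncomputable def lowDegree {n : ℕ} (d : ℕ) (G : SimpleGraph (Fin n)) : Finset (Fin n) :=
  Finset.univ.filter fun v => G.degree v ≤ d

/-- The expected number of `r`-sets of vertices of degree at most `d`. -/
noncomputable def binomialMoment (n M d r : ℕ) : ℝ :=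
  (∑ G ∈ gnmGraphs n M, ((lowDegree d G).card.choose r : ℝ)) / ((n.choose 2).choose M : ℕ)

lemma binomialMoment_eq (n M d r : ℕ) :
    binomialMoment n M d r = ∑ R ∈ Finset.powersetCard r (Finset.univ : Finset (Fin n)),
      gnmProb n M {G | ∀ v ∈ R, G.degree v ≤ d} := by
  simp_rw [gnmProb_eq]
  rw [← Finset.sum_div, binomialMoment]
  congr 1
  simp_rw [Finset.card_filter]
  push_cast
  rw [Finset.sum_comm]
  refine Finset.sum_congr rfl fun G _ => ?_
  rw [← Finset.card_powersetCard]
  have : Finset.powersetCard r (lowDegree d G) =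
      (Finset.powersetCard r (Finset.univ : Finset (Fin n))).filter
        fun R => G ∈ {G : SimpleGraph (Fin n) | ∀ v ∈ R, G.degree v ≤ d} := by
    ext R
    simp only [Finset.mem_powersetCard, Finset.mem_filter, lowDegree, Finset.subset_iff,
      Finset.mem_univ, true_and, Set.mem_ofPred_eq]
    tauto
  rw [this, Finset.card_filter]
  push_cast
  rfl

/-- The possible families of outer neighbourhoods, with at most `d` elements each, for the
vertices of `R`. -/
noncomputable def outerFamilies {n : ℕ} (d : ℕ) (R : Finset (Fin n)) :
    Finset (Fin n → Finset (Fin n)) :=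
  Fintype.piFinset fun v => if v ∈ R then Rᶜ.powerset.filter (fun S => S.card ≤ d) else {∅}

lemma mem_outerFamilies {n d : ℕ} {R : Finset (Fin n)} {S : Fin n → Finset (Fin n)}
    (hS : S ∈ outerFamilies d R) {v : Fin n} (hv : v ∈ R) : S v ⊆ Rᶜ ∧ (S v).card ≤ d := by
  have := Fintype.mem_piFinset.1 hS v
  rw [if_pos hv] at this
  simpa using this

lemma sum_outerFamilies_pow {n : ℕ} (d : ℕ) (R : Finset (Fin n)) (z : ℝ) :
    ∑ S ∈ outerFamilies d R, z ^ (∑ v ∈ R, (S v).card) =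
      (∑ j ∈ Finset.range (d + 1), ((n - R.card).choose j : ℝ) * z ^ j) ^ R.card := by
  have h1 := Finset.prod_univ_sum
    (fun v => if v ∈ R then Rᶜ.powerset.filter (fun S : Finset (Fin n) => S.card ≤ d) else {∅})
    (fun (_ : Fin n) (S : Finset (Fin n)) => z ^ S.card)
  have h2 : ∀ v, (∑ S ∈ if v ∈ R then Rᶜ.powerset.filter (fun S : Finset (Fin n) => S.card ≤ d)
      else {∅}, z ^ S.card) =
      if v ∈ R then ∑ j ∈ Finset.range (d + 1), ((n - R.card).choose j : ℝ) * z ^ j else 1 := by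
    intro v
    split_ifs
    · rw [sum_powerset_filter_card_le Rᶜ d (fun s => z ^ s), Finset.card_compl, Fintype.card_fin]
    · simp
  simp_rw [h2] at h1
  rw [Finset.prod_ite_mem, Finset.univ_inter, Finset.prod_const] at h1
  rw [h1]
  refine Finset.sum_congr rfl fun S hS => ?_
  rw [Finset.prod_pow_eq_pow_sum]
  congr 1
  refine Finset.sum_subset (Finset.subset_univ R) fun v _ hv => ?_
  have := Fintype.mem_piFinset.1 hS v
  rw [if_neg hv, Finset.mem_singleton] at this
  rw [this, Finset.card_empty]

/-- The pairs joining `R` to its complement that are selected by the family `S`. -/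
noncomputable def outerPairs {n : ℕ} (R : Finset (Fin n)) (S : Fin n → Finset (Fin n)) :
    Finset (Fin n × Fin n) :=
  (R ×ˢ Rᶜ).filter fun p => p.2 ∈ S p.1

lemma card_outerPairs {n d : ℕ} {R : Finset (Fin n)} {S : Fin n → Finset (Fin n)}
    (hS : S ∈ outerFamilies d R) : (outerPairs R S).card = ∑ v ∈ R, (S v).card := by
  rw [outerPairs, Finset.card_filter, Finset.sum_product]
  refine Finset.sum_congr rfl fun v hv => ?_
  rw [← Finset.card_filter]
  congr 1
  ext w
  rw [Finset.mem_filter]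
  exact ⟨fun h => h.2, fun h => ⟨(mem_outerFamilies hS hv).1 h, h⟩⟩

lemma sum_card_outerFamilies_le {n d : ℕ} {R : Finset (Fin n)} {S : Fin n → Finset (Fin n)}
    (hS : S ∈ outerFamilies d R) : ∑ v ∈ R, (S v).card ≤ R.card * d := by
  rw [← smul_eq_mul]
  exact Finset.sum_le_card_nsmul _ _ _ fun v hv => (mem_outerFamilies hS hv).2

/-- Partitioning according to the outer neighbourhoods of `R`. -/
lemma card_filter_outer_eq_sum {n d : ℕ} (R : Finset (Fin n))
    (A : Finset (SimpleGraph (Fin n))) :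
    (A.filter fun G => ∀ v ∈ R, (G.neighborFinset v \ R).card ≤ d).card =
      ∑ S ∈ outerFamilies d R,
        (A.filter fun G => ∀ p ∈ R ×ˢ Rᶜ, (G.Adj p.1 p.2 ↔ p ∈ outerPairs R S)).card := by
  let f : SimpleGraph (Fin n) → Fin n → Finset (Fin n) := fun G v =>
    if v ∈ R then G.neighborFinset v \ R else ∅
  have hf : ∀ G, (∀ v ∈ R, (G.neighborFinset v \ R).card ≤ d) ↔ f G ∈ outerFamilies d R := by
    intro G
    rw [outerFamilies, Fintype.mem_piFinset]
    refine forall_congr' fun v => ?_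
    by_cases hv : v ∈ R
    · simp only [f, hv, if_true, forall_true_left, Finset.mem_filter, Finset.mem_powerset]
      refine (and_iff_right ?_).symm
      intro w hw
      exact Finset.mem_compl.2 (Finset.mem_sdiff.1 hw).2
    · simp [f, hv]
  rw [Finset.card_eq_sum_card_fiberwise (f := f) (t := outerFamilies d R)]
  · refine Finset.sum_congr rfl fun S hS => ?_
    rw [Finset.filter_filter]
    congr 1
    refine Finset.filter_congr fun G _ => ?_
    constructor
    · rintro ⟨-, rfl⟩ ⟨v, w⟩ hp
      obtain ⟨hv, hw⟩ := Finset.mem_product.1 hp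
      have hw' := Finset.mem_compl.1 hw
      simp only at hv hw'
      simp [outerPairs, f, hv, hw']
    · intro h
      have hfS : f G = S := by
        funext v
        by_cases hv : v ∈ R
        · ext w
          by_cases hw : w ∈ R
          · have hwS : w ∉ S v := fun hws =>
              Finset.mem_compl.1 ((mem_outerFamilies hS hv).1 hws) hw
            simp [f, hv, hw, hwS]
          · have := h (v, w) (Finset.mk_mem_product hv (Finset.mem_compl.2 hw))
            simp only [outerPairs, Finset.mem_filter, Finset.mem_product, Finset.mem_compl, hv, hw,
              not_false_eq_true, and_self, true_and] at this
            simp [f, hv, hw, this]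
        · have := Fintype.mem_piFinset.1 hS v
          rw [if_neg hv, Finset.mem_singleton] at this
          simp [f, hv, this]
      exact ⟨(hf G).2 (hfS ▸ hS), hfS⟩
  · intro G hG
    exact (hf G).1 (Finset.mem_filter.1 hG).2

lemma injOn_sym2_product_compl {n : ℕ} (R : Finset (Fin n)) :
    Set.InjOn (fun p : Fin n × Fin n => s(p.1, p.2)) (R ×ˢ Rᶜ : Finset (Fin n × Fin n)) := by
  rintro ⟨a, b⟩ hp ⟨a', b'⟩ hq h
  simp only [Finset.coe_product, Set.mem_prod, Finset.mem_coe, Finset.mem_compl] at hp hq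
  rcases Sym2.eq_iff.1 h with ⟨h1, h2⟩ | ⟨h1, h2⟩
  · exact Prod.ext h1 h2
  · simp only at h1 h2
    exact absurd (h1 ▸ hp.1) hq.2

lemma gnmProb_outer_eq_sum {n M d : ℕ} (R : Finset (Fin n)) (hM : R.card * d ≤ M) :
    gnmProb n M {G | ∀ v ∈ R, (G.neighborFinset v \ R).card ≤ d} =
      ∑ S ∈ outerFamilies d R, patternProb (n.choose 2) M (∑ v ∈ R, (S v).card)
        (R.card * (n - R.card) - ∑ v ∈ R, (S v).card) := by
  rw [gnmProb_eq]
  simp only [Set.mem_ofPred_eq]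
  rw [card_filter_outer_eq_sum, Nat.cast_sum, Finset.sum_div]
  refine Finset.sum_congr rfl fun S hS => ?_
  have hsub : outerPairs R S ⊆ R ×ˢ Rᶜ := Finset.filter_subset _ _
  have hc := card_outerPairs hS
  have hle := Finset.card_le_card hsub
  rw [hc, Finset.card_product, Finset.card_compl, Fintype.card_fin] at hle
  rw [card_gnmGraphs_filter_trace hsub ?_ (injOn_sym2_product_compl R)
    (by rw [hc]; exact (sum_card_outerFamilies_le hS).trans hM), patternProb, hc,
    Finset.card_product, Finset.card_compl, Fintype.card_fin, Nat.add_sub_cancel' hle]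
  intro p hp h
  rw [Finset.mem_product, ← h] at hp
  exact Finset.mem_compl.1 hp.2 hp.1

lemma gnmProb_outer_and_adj_le {n M d : ℕ} (R : Finset (Fin n)) {u w : Fin n} (hu : u ∈ R)
    (hw : w ∈ R) (huw : u ≠ w) (hM : R.card * d + 1 ≤ M) :
    gnmProb n M {G | (∀ v ∈ R, (G.neighborFinset v \ R).card ≤ d) ∧ G.Adj u w} ≤
      ∑ S ∈ outerFamilies d R, patternProb (n.choose 2) M (∑ v ∈ R, (S v).card + 1)
        (R.card * (n - R.card) - ∑ v ∈ R, (S v).card) := by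
  rw [gnmProb_eq]
  simp only [Set.mem_ofPred_eq]
  have hand : (gnmGraphs n M).filter
      (fun G => (∀ v ∈ R, (G.neighborFinset v \ R).card ≤ d) ∧ G.Adj u w) =
      ((gnmGraphs n M).filter fun G => G.Adj u w).filter
        fun G => ∀ v ∈ R, (G.neighborFinset v \ R).card ≤ d := by
    rw [Finset.filter_filter]
    exact Finset.filter_congr fun G _ => and_comm
  rw [hand, card_filter_outer_eq_sum, Nat.cast_sum, Finset.sum_div]
  refine Finset.sum_le_sum fun S hS => ?_
  have hsub : outerPairs R S ⊆ R ×ˢ Rᶜ := Finset.filter_subset _ _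
  have hc := card_outerPairs hS
  have hle := Finset.card_le_card hsub
  rw [hc, Finset.card_product, Finset.card_compl, Fintype.card_fin] at hle
  have hnot : (u, w) ∉ R ×ˢ Rᶜ := by simp [hw]
  have hX : ∀ p ∈ insert (u, w) (R ×ˢ Rᶜ), p.1 ≠ p.2 := by
    intro p hp h
    rcases Finset.mem_insert.1 hp with rfl | hp
    · exact huw h
    · rw [Finset.mem_product, ← h] at hp
      exact Finset.mem_compl.1 hp.2 hp.1
  have hinj : Set.InjOn (fun p : Fin n × Fin n => s(p.1, p.2))
      (insert (u, w) (R ×ˢ Rᶜ) : Finset (Fin n × Fin n)) := by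
    rw [Finset.coe_insert, Set.injOn_insert (by simpa using hnot)]
    refine ⟨injOn_sym2_product_compl R, ?_⟩
    rintro ⟨⟨a, b⟩, hp, h⟩
    have hb := (Finset.mem_product.1 (Finset.mem_coe.1 hp)).2
    rcases Sym2.eq_iff.1 h with ⟨h1, h2⟩ | ⟨h1, h2⟩
    · simp only at h2 hb
      exact Finset.mem_compl.1 hb (h2 ▸ hw)
    · simp only at h2 hb
      exact Finset.mem_compl.1 hb (h2 ▸ hu)
  have hcT : (insert (u, w) (outerPairs R S)).card = ∑ v ∈ R, (S v).card + 1 := by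
    rw [Finset.card_insert_of_notMem fun h => hnot (hsub h), hc]
  have hcX : (insert (u, w) (R ×ˢ Rᶜ)).card = R.card * (n - R.card) + 1 := by
    rw [Finset.card_insert_of_notMem hnot, Finset.card_product, Finset.card_compl,
      Fintype.card_fin]
  have key := card_gnmGraphs_filter_trace (M := M) (Finset.insert_subset_insert (u, w) hsub) hX hinj
    (by rw [hcT]; have := sum_card_outerFamilies_le hS; omega)
  rw [hcT, hcX] at key
  rw [patternProb]
  gcongr
  rw [show ∑ v ∈ R, (S v).card + 1 + (R.card * (n - R.card) - ∑ v ∈ R, (S v).card) =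
    R.card * (n - R.card) + 1 by omega, ← key, Finset.filter_filter]
  refine Finset.card_le_card fun G hG => ?_
  rw [Finset.mem_filter] at hG ⊢
  obtain ⟨h0, h1, h2⟩ := hG
  refine ⟨h0, fun p hp => ?_⟩
  rcases Finset.mem_insert.1 hp with rfl | hp
  · simpa using h1
  · rw [h2 p hp, Finset.mem_insert, or_iff_right]
    rintro rfl
    exact hnot hp

lemma gnmProb_nonneg (n M : ℕ) (A : Set (SimpleGraph (Fin n))) : 0 ≤ gnmProb n M A := by
  unfold gnmProb; positivity

lemma gnmProb_mono (n M : ℕ) {A B : Set (SimpleGraph (Fin n))}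
    (h : ∀ G, edgeCount G = M → G ∈ A → G ∈ B) : gnmProb n M A ≤ gnmProb n M B := by
  rw [gnmProb_eq, gnmProb_eq]
  refine div_le_div_of_nonneg_right (Nat.cast_le.2 (Finset.card_le_card fun G hG => ?_))
    (by positivity)
  rw [Finset.mem_filter] at hG ⊢
  exact ⟨hG.1, h G (mem_gnmGraphs.1 hG.1) hG.2⟩

lemma gnmProb_union_le (n M : ℕ) (A B : Set (SimpleGraph (Fin n))) :
    gnmProb n M (A ∪ B) ≤ gnmProb n M A + gnmProb n M B := by
  rw [gnmProb_eq, gnmProb_eq, gnmProb_eq, ← add_div]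
  gcongr
  simp only [Set.mem_union]
  rw [Finset.filter_or]
  exact_mod_cast Finset.card_union_le _ _

lemma gnmProb_biUnion_le {ι : Type*} (n M : ℕ) (I : Finset ι)
    (A : ι → Set (SimpleGraph (Fin n))) :
    gnmProb n M {G | ∃ i ∈ I, G ∈ A i} ≤ ∑ i ∈ I, gnmProb n M (A i) := by
  induction I using Finset.induction_on with
  | empty => simp [gnmProb]
  | insert i I hi ih =>
    rw [Finset.sum_insert hi]
    refine (gnmProb_mono n M (B := A i ∪ {G | ∃ i ∈ I, G ∈ A i}) ?_).trans
      ((gnmProb_union_le n M _ _).trans (by gcongr))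
    rintro G - ⟨j, hj, h⟩
    rcases Finset.mem_insert.1 hj with rfl | hj
    · exact Or.inl h
    · exact Or.inr ⟨j, hj, h⟩

lemma degree_le_of_outer {n d : ℕ} {R : Finset (Fin n)} {G : SimpleGraph (Fin n)}
    (h : ∀ u ∈ R, ∀ w ∈ R, ¬ G.Adj u w) {v : Fin n} (hv : v ∈ R)
    (hd : (G.neighborFinset v \ R).card ≤ d) : G.degree v ≤ d := by
  rw [← SimpleGraph.card_neighborFinset_eq_degree]
  convert hd using 2
  ext w
  simp only [SimpleGraph.mem_neighborFinset, Finset.mem_sdiff]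
  exact ⟨fun hw => ⟨hw, fun hwR => h v hv w hwR hw⟩, fun hw => hw.1⟩

lemma outer_le_of_degree {n d : ℕ} {R : Finset (Fin n)} {G : SimpleGraph (Fin n)}
    {v : Fin n} (hd : G.degree v ≤ d) : (G.neighborFinset v \ R).card ≤ d := by
  rw [← SimpleGraph.card_neighborFinset_eq_degree] at hd
  exact (Finset.card_le_card Finset.sdiff_subset).trans hd

/-- Two-sided estimates for the probability that all vertices of `R` have degree at most `d`, in
terms of the probability that they have at most `d` neighbours outside `R`. -/
lemma gnmProb_degree_le_bounds {n M d r : ℕ} {R : Finset (Fin n)} (hR : R.card = r)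
    (hM : r * d + 1 ≤ M) (hMN : M ≤ n.choose 2) (hrn : r * (n - r) < n.choose 2) (hd : r + d ≤ n) :
    gnmProb n M {G | ∀ v ∈ R, G.degree v ≤ d} ≤
      gnmProb n M {G | ∀ v ∈ R, (G.neighborFinset v \ R).card ≤ d} ∧
    gnmProb n M {G | ∀ v ∈ R, (G.neighborFinset v \ R).card ≤ d} *
        (1 - r ^ 2 * ((M : ℝ) / (n.choose 2 - (r * (n - r) : ℕ)))) ≤
      gnmProb n M {G | ∀ v ∈ R, G.degree v ≤ d} := by
  subst hR
  refine ⟨gnmProb_mono n M fun G _ hG v hv => outer_le_of_degree (hG v hv), ?_⟩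
  set η : ℝ := (M : ℝ) / (n.choose 2 - (R.card * (n - R.card) : ℕ)) with hη
  have hη0 : 0 ≤ η := by
    apply div_nonneg (by positivity)
    have : ((R.card * (n - R.card) : ℕ) : ℝ) < n.choose 2 := by exact_mod_cast hrn
    linarith
  set P := gnmProb n M {G | ∀ v ∈ R, (G.neighborFinset v \ R).card ≤ d} with hP
  have hP0 : 0 ≤ P := gnmProb_nonneg _ _ _
  have hedge : ∀ p ∈ (R ×ˢ R).filter (fun p => p.1 ≠ p.2), gnmProb n M
      {G | (∀ v ∈ R, (G.neighborFinset v \ R).card ≤ d) ∧ G.Adj p.1 p.2} ≤ P * η := by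
    intro p hp
    rw [Finset.mem_filter, Finset.mem_product] at hp
    refine (gnmProb_outer_and_adj_le R hp.1.1 hp.1.2 hp.2 hM).trans ?_
    rw [hP, gnmProb_outer_eq_sum R (by omega), Finset.sum_mul]
    refine Finset.sum_le_sum fun S hS => ?_
    have h1 := sum_card_outerFamilies_le hS
    have h2 : R.card * d ≤ R.card * (n - R.card) := Nat.mul_le_mul_left _ (by omega)
    exact patternProb_succ_le (by omega) hMN (by omega) hrn
  have hcover : P ≤ gnmProb n M {G | ∀ v ∈ R, G.degree v ≤ d} +
      ∑ p ∈ (R ×ˢ R).filter (fun p => p.1 ≠ p.2), gnmProb n M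
        {G | (∀ v ∈ R, (G.neighborFinset v \ R).card ≤ d) ∧ G.Adj p.1 p.2} := by
    refine le_trans ?_ (add_le_add_right (gnmProb_biUnion_le n M _ _) _)
    refine le_trans ?_ (gnmProb_union_le _ _ _ _)
    refine gnmProb_mono n M fun G _ hG => ?_
    by_cases h : ∀ u ∈ R, ∀ w ∈ R, ¬ G.Adj u w
    · exact Or.inl fun v hv => degree_le_of_outer h hv (hG v hv)
    · push Not at h
      obtain ⟨u, hu, w, hw, huw⟩ := h
      exact Or.inr ⟨(u, w), Finset.mem_filter.2 ⟨Finset.mk_mem_product hu hw, huw.ne⟩, hG, huw⟩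
  have hsum := Finset.sum_le_card_nsmul _ _ _ hedge
  have hcard : (((R ×ˢ R).filter (fun p => p.1 ≠ p.2)).card : ℝ) ≤ (R.card : ℝ) ^ 2 := by
    rw [sq]
    exact_mod_cast (Finset.card_filter_le _ _).trans (Finset.card_product R R).le
  rw [nsmul_eq_mul] at hsum
  have := mul_le_mul_of_nonneg_right hcard (mul_nonneg hP0 hη0)
  nlinarith

/-- If the pattern probabilities with `a ≤ r * d` edges are `z ^ a * E` up to a relative error `δ`,
then the binomial moment is determined up to comparable errors. -/
lemma binomialMoment_bounds {n M d r : ℕ} {z E δ : ℝ}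
    (hM : r * d + 1 ≤ M) (hMN : M ≤ n.choose 2) (hrn : r * (n - r) < n.choose 2) (hd : r + d ≤ n)
    (hδ : ∀ a ≤ r * d, |patternProb (n.choose 2) M a (r * (n - r) - a) - z ^ a * E| ≤
      δ * (z ^ a * E))
    (hη : r ^ 2 * ((M : ℝ) / (n.choose 2 - (r * (n - r) : ℕ))) ≤ 1) :
    binomialMoment n M d r ≤ (1 + δ) * (n.choose r *
      (E * (∑ j ∈ Finset.range (d + 1), ((n - r).choose j : ℝ) * z ^ j) ^ r)) ∧
    (1 - r ^ 2 * ((M : ℝ) / (n.choose 2 - (r * (n - r) : ℕ)))) * (1 - δ) * (n.choose r *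
      (E * (∑ j ∈ Finset.range (d + 1), ((n - r).choose j : ℝ) * z ^ j) ^ r)) ≤
      binomialMoment n M d r := by
  set W := ∑ j ∈ Finset.range (d + 1), ((n - r).choose j : ℝ) * z ^ j with hW
  set η := r ^ 2 * ((M : ℝ) / (n.choose 2 - (r * (n - r) : ℕ)))
  have houter : ∀ R ∈ Finset.powersetCard r (Finset.univ : Finset (Fin n)),
      gnmProb n M {G | ∀ v ∈ R, (G.neighborFinset v \ R).card ≤ d} ≤ (1 + δ) * (E * W ^ r) ∧
      (1 - δ) * (E * W ^ r) ≤ gnmProb n M {G | ∀ v ∈ R, (G.neighborFinset v \ R).card ≤ d} := by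
    intro R hR
    have hRr := (Finset.mem_powersetCard.1 hR).2
    have hsum : E * W ^ r = ∑ S ∈ outerFamilies d R, z ^ (∑ v ∈ R, (S v).card) * E := by
      rw [← Finset.sum_mul, sum_outerFamilies_pow, hRr, hW, mul_comm]
    rw [gnmProb_outer_eq_sum R (by rw [hRr]; omega), hsum, Finset.mul_sum, Finset.mul_sum, hRr]
    constructor <;> refine Finset.sum_le_sum fun S hS => ?_ <;>
    · have h1 := sum_card_outerFamilies_le hS
      rw [hRr] at h1
      have h2 := abs_le.1 (hδ _ h1)
      linarith [h2.1, h2.2]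
  have hcard : (Finset.powersetCard r (Finset.univ : Finset (Fin n))).card = n.choose r := by
    rw [Finset.card_powersetCard, Finset.card_univ, Fintype.card_fin]
  rw [binomialMoment_eq]
  constructor
  · calc _ ≤ ∑ R ∈ Finset.powersetCard r (Finset.univ : Finset (Fin n)),
          (1 + δ) * (E * W ^ r) := Finset.sum_le_sum fun R hR =>
          (gnmProb_degree_le_bounds (Finset.mem_powersetCard.1 hR).2 hM hMN hrn hd).1.trans
            (houter R hR).1
      _ = _ := by rw [Finset.sum_const, hcard, nsmul_eq_mul]; ring
  · calc _ = ∑ R ∈ Finset.powersetCard r (Finset.univ : Finset (Fin n)),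
          (1 - δ) * (E * W ^ r) * (1 - η) := by
          rw [Finset.sum_const, hcard, nsmul_eq_mul]; ring
      _ ≤ _ := Finset.sum_le_sum fun R hR =>
          (mul_le_mul_of_nonneg_right (houter R hR).2 (by linarith)).trans
            (gnmProb_degree_le_bounds (Finset.mem_powersetCard.1 hR).2 hM hMN hrn hd).2

lemma tendsto_one_sub_pow_mul_exp {z c : ℕ → ℝ} {b : ℕ → ℕ} (hz : Tendsto z atTop (nhds 0))
    (h1 : Tendsto (fun n => b n * z n - c n) atTop (nhds 0))
    (h2 : Tendsto (fun n => b n * z n ^ 2) atTop (nhds 0)) :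
    Tendsto (fun n => (1 - z n) ^ b n * Real.exp (c n)) atTop (nhds 1) := by
  have h3 : Tendsto (fun n => b n * (Real.log (1 - z n) + z n)) atTop (nhds 0) := by
    refine squeeze_zero_norm' (a := fun n => 2 * (b n * z n ^ 2)) ?_ (by simpa using h2.const_mul 2)
    filter_upwards [hz.eventually (Metric.ball_mem_nhds 0 (by norm_num : (0 : ℝ) < 1 / 2))] with n hn
    have hn' : |z n| < 1 / 2 := by simpa using hn
    have h := Real.abs_log_sub_add_sum_range_le (x := z n) (by linarith) 1
    simp only [Finset.sum_range_one, zero_add, pow_one, Nat.cast_zero, div_one] at h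
    rw [Real.norm_eq_abs, abs_mul, Nat.abs_cast, add_comm, mul_left_comm]
    refine mul_le_mul_of_nonneg_left (h.trans ?_) (Nat.cast_nonneg _)
    rw [div_le_iff₀ (by linarith), ← sq_abs (z n)]
    change |z n| ^ 2 ≤ _
    nlinarith [mul_nonneg (sq_nonneg |z n|) (by linarith : 0 ≤ 1 - 2 * |z n|)]
  have h4 : Tendsto (fun n => Real.exp (b n * (Real.log (1 - z n) + z n) - (b n * z n - c n)))
      atTop (nhds 1) := by
    have := (Real.continuous_exp.tendsto _).comp (h3.sub h1)
    rwa [sub_zero, Real.exp_zero] at this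
  refine h4.congr' ?_
  filter_upwards [hz.eventually (gt_mem_nhds (by norm_num : (0 : ℝ) < 1))] with n hn
  rw [show b n * (Real.log (1 - z n) + z n) - (b n * z n - c n) =
    b n * Real.log (1 - z n) + c n by ring, Real.exp_add, Real.exp_nat_mul,
    Real.exp_log (by linarith)]

lemma tendsto_one_sub_pow_mul_exp_of_pow_div {x : ℕ → ℝ}
    (hpow : ∀ j : ℕ, Tendsto (fun n : ℕ => x n ^ j / n) atTop (nhds 0)) (r a : ℕ) (q₀ q₁ : ℝ) :
    Tendsto (fun n : ℕ => (1 - ((n : ℝ) / 2 * x n - a) /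
      ((n : ℝ) * (n - 1) / 2 - (q₀ + q₁ * n))) ^ (r * (n - r) - a) * Real.exp (r * x n))
      atTop (nhds 1) := by
  rcases Nat.eq_zero_or_pos r with rfl | hr
  · simp
  have hu : Tendsto (fun n : ℕ => (1 : ℝ) / n) atTop (nhds 0) := by simpa using hpow 0
  have hv : Tendsto (fun n : ℕ => x n / n) atTop (nhds 0) := by simpa using hpow 1
  have hw := hpow 2
  have hD : Tendsto (fun n : ℕ => 1 / 2 - 1 / n / 2 - q₀ * (1 / (n : ℝ)) ^ 2 - q₁ * (1 / n))
      atTop (nhds (1 / 2)) := by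
    have := (((hu.div_const 2).const_sub (1 / 2)).sub ((hu.pow 2).const_mul q₀)).sub
      (hu.const_mul q₁)
    simpa using this
  have hDpos : ∀ᶠ n : ℕ in atTop,
      1 / 2 - 1 / n / 2 - q₀ * (1 / (n : ℝ)) ^ 2 - q₁ * (1 / n) ≠ 0 :=
    hD.eventually_ne (by norm_num)
  have hA : Tendsto (fun n : ℕ => x n / n / 2 - a * (1 / (n : ℝ)) ^ 2) atTop (nhds 0) := by
    simpa using (hv.div_const 2).sub ((hu.pow 2).const_mul (a : ℝ))
  have hZ : ∀ᶠ n : ℕ in atTop, ((n : ℝ) / 2 * x n - a) / ((n : ℝ) * (n - 1) / 2 - (q₀ + q₁ * n)) =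
      (x n / n / 2 - a * (1 / (n : ℝ)) ^ 2) /
        (1 / 2 - 1 / n / 2 - q₀ * (1 / (n : ℝ)) ^ 2 - q₁ * (1 / n)) := by
    filter_upwards [eventually_gt_atTop 0] with n hn
    have hn' : (n : ℝ) ≠ 0 := by positivity
    rw [← mul_div_mul_left (x n / n / 2 - a * (1 / (n : ℝ)) ^ 2) _ (pow_ne_zero 2 hn')]
    congr 1
    · field_simp
    · field_simp
      ring
  have hb : ∀ᶠ n : ℕ in atTop, ((r * (n - r) - a : ℕ) : ℝ) = r * n - (r ^ 2 + a) := by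
    filter_upwards [eventually_ge_atTop (r + a)] with n hn
    have h1 : a ≤ n - r := by omega
    rw [Nat.cast_sub (h1.trans (Nat.le_mul_of_pos_left _ hr)), Nat.cast_mul,
      Nat.cast_sub (by omega)]
    ring
  refine tendsto_one_sub_pow_mul_exp ?_ ?_ ?_
  · have := hA.div hD (by norm_num)
    rw [zero_div] at this
    exact this.congr' (hZ.mono fun n h => h.symm)
  · have hN : Tendsto (fun n : ℕ => -(r * a * (1 / (n : ℝ))) - (r ^ 2 + a) * (x n / n) / 2 +
        (r ^ 2 + a) * a * (1 / (n : ℝ)) ^ 2 + r * (x n / n) / 2 +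
        r * (x n / n) * (q₀ * (1 / n) + q₁)) atTop (nhds 0) := by
      have := (((((hu.const_mul ((r : ℝ) * a)).neg).sub
        ((hv.const_mul ((r : ℝ) ^ 2 + a)).div_const 2)).add
        ((hu.pow 2).const_mul (((r : ℝ) ^ 2 + a) * a))).add
        ((hv.const_mul (r : ℝ)).div_const 2)).add
        ((hv.const_mul (r : ℝ)).mul ((hu.const_mul q₀).add_const q₁))
      simpa using this
    have := hN.div hD (by norm_num)
    rw [zero_div] at this
    refine this.congr' ?_
    filter_upwards [hZ, hb, hDpos, eventually_gt_atTop 0] with n h1 h2 h3 hn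
    have hn' : (n : ℝ) ≠ 0 := by positivity
    rw [h1]
    rw [h2]
    simp only [Pi.div_apply]
    rw [div_eq_iff h3, sub_mul, mul_assoc (r * (n : ℝ) - _), div_mul_cancel₀ _ h3]
    field_simp
    ring
  · have hN : Tendsto (fun n : ℕ => (r - (r ^ 2 + a) * (1 / (n : ℝ))) *
        (x n ^ 2 / n / 4 - a * (x n / n) * (1 / n) + a ^ 2 * (1 / (n : ℝ)) ^ 3))
        atTop (nhds 0) := by
      have := ((hu.const_mul ((r : ℝ) ^ 2 + a)).const_sub (r : ℝ)).mul
        (((hw.div_const 4).sub ((hv.const_mul (a : ℝ)).mul hu)).add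
          ((hu.pow 3).const_mul ((a : ℝ) ^ 2)))
      simpa using this
    have := hN.div (hD.pow 2) (by norm_num)
    rw [zero_div] at this
    refine this.congr' ?_
    filter_upwards [hZ, hb, hDpos, eventually_gt_atTop 0] with n h1 h2 h3 hn
    have hn' : (n : ℝ) ≠ 0 := by positivity
    rw [h1]
    rw [h2, div_pow]
    simp only [Pi.div_apply]
    rw [mul_div_assoc']
    field_simp
    ring

lemma tendsto_ratio_mean_degree {x : ℕ → ℝ} (hx : Tendsto x atTop atTop) (a b : ℕ) :
    Tendsto (fun n : ℕ => ((n : ℝ) / 2 * x n - a) / ((n : ℝ) * (n - 1) / 2 - b) / (x n / n))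
      atTop (nhds 1) := by
  have hu : Tendsto (fun n : ℕ => (1 : ℝ) / n) atTop (nhds 0) := tendsto_one_div_atTop_nhds_zero_nat
  have hv : Tendsto (fun n : ℕ => (x n)⁻¹) atTop (nhds 0) := tendsto_inv_atTop_zero.comp hx
  have h1 : Tendsto (fun n : ℕ => 1 / 2 - a * ((1 / (n : ℝ)) * (x n)⁻¹)) atTop (nhds (1 / 2)) := by
    simpa only [mul_zero, sub_zero] using ((hu.mul hv).const_mul (a : ℝ)).const_sub (1 / 2)
  have h2 : Tendsto (fun n : ℕ => 1 / 2 - 1 / (n : ℝ) / 2 - b * (1 / (n : ℝ)) ^ 2)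
      atTop (nhds (1 / 2)) := by
    have := ((hu.div_const 2).const_sub (1 / 2)).sub ((hu.pow 2).const_mul (b : ℝ))
    simpa using this
  have h3 := h1.div h2 (by norm_num)
  rw [div_self (by norm_num)] at h3
  refine h3.congr' ?_
  filter_upwards [eventually_gt_atTop 0, hx.eventually_gt_atTop 0] with n hn hxn
  have hn' : (n : ℝ) ≠ 0 := by positivity
  have hxn' := hxn.ne'
  simp only [Pi.div_apply]
  rw [div_div ((n : ℝ) / 2 * x n - a), ← mul_div_mul_right (1 / 2 - _) _ (mul_ne_zero hn' hxn')]
  congr 1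
  · field_simp
  · field_simp

lemma eventually_edges_add_lt_choose_two {M : ℕ → ℕ} {x : ℕ → ℝ}
    (hM : ∀ n : ℕ, (M n : ℝ) = n / 2 * x n)
    (hv : Tendsto (fun n : ℕ => x n / n) atTop (nhds 0)) (r a : ℕ) :
    ∀ᶠ n : ℕ in atTop, M n + r * (n - r) + a < n.choose 2 := by
  have hu : Tendsto (fun n : ℕ => (1 : ℝ) / n) atTop (nhds 0) := tendsto_one_div_atTop_nhds_zero_nat
  have h : Tendsto (fun n : ℕ => 1 / 2 - 1 / (n : ℝ) / 2 - x n / n / 2 - r * (1 / n) -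
      a * (1 / (n : ℝ)) ^ 2) atTop (nhds (1 / 2)) := by
    have := ((((hu.div_const 2).const_sub (1 / 2)).sub (hv.div_const 2)).sub
      (hu.const_mul (r : ℝ))).sub ((hu.pow 2).const_mul (a : ℝ))
    simpa using this
  filter_upwards [h.eventually (lt_mem_nhds (by norm_num : (0 : ℝ) < 1 / 2)),
    eventually_gt_atTop 0] with n h1 hn
  have hn' : (0 : ℝ) < n := by positivity
  have h2 : ((M n + r * n + a : ℕ) : ℝ) < (n.choose 2 : ℕ) := by
    rw [Nat.cast_choose_two]
    push_cast
    rw [hM n]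
    have := mul_pos (pow_pos hn' 2) h1
    have h3 : (n : ℝ) ^ 2 * (1 / 2 - 1 / (n : ℝ) / 2 - x n / n / 2 - r * (1 / n) -
      a * (1 / (n : ℝ)) ^ 2) = n * (n - 1) / 2 - (n / 2 * x n + r * n + a) := by
      field_simp
      ring
    linarith
  have h3 := Nat.cast_lt.1 h2
  have h4 : r * (n - r) ≤ r * n := Nat.mul_le_mul_left r (Nat.sub_le n r)
  omega

lemma eventually_le_edges {M : ℕ → ℕ} {x : ℕ → ℝ}
    (hM : ∀ n : ℕ, (M n : ℝ) = n / 2 * x n) (hx : Tendsto x atTop atTop) (a : ℕ) :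
    ∀ᶠ n : ℕ in atTop, a ≤ M n := by
  filter_upwards [hx.eventually_ge_atTop (2 * a), eventually_ge_atTop 1] with n h1 h2
  have h2' : (1 : ℝ) ≤ n := by exact_mod_cast h2
  have : (a : ℝ) ≤ M n := by rw [hM n]; nlinarith [(Nat.cast_nonneg a : (0 : ℝ) ≤ a)]
  exact_mod_cast this

/-- Asymptotics of the probability that prescribed `a` of the pairs leaving an `r`-set are edges
and the others are not. -/
lemma tendsto_patternProb_div {M : ℕ → ℕ} {x : ℕ → ℝ}
    (hM : ∀ n : ℕ, (M n : ℝ) = n / 2 * x n) (hx : Tendsto x atTop atTop)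
    (hpow : ∀ j : ℕ, Tendsto (fun n : ℕ => x n ^ j / n) atTop (nhds 0)) (r a : ℕ) :
    Tendsto (fun n : ℕ => patternProb (n.choose 2) (M n) a (r * (n - r) - a) /
      ((x n / n) ^ a * Real.exp (-(r * x n)))) atTop (nhds 1) := by
  have hroom := eventually_edges_add_lt_choose_two hM (by simpa using hpow 1) r a
  have hMa := eventually_le_edges hM hx a
  obtain ⟨q₀, q₁, hq⟩ : ∃ q₀ q₁ : ℝ, ∀ᶠ n : ℕ in atTop,
      (a : ℝ) + (r * (n - r) - a : ℕ) = q₀ + q₁ * n := by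
    rcases Nat.eq_zero_or_pos r with rfl | hr
    · exact ⟨a, 0, by simp⟩
    refine ⟨-(r ^ 2), r, ?_⟩
    filter_upwards [eventually_ge_atTop (r + a)] with n hn
    have h1 : a ≤ n - r := by omega
    rw [Nat.cast_sub (h1.trans (Nat.le_mul_of_pos_left _ hr)), Nat.cast_mul,
      Nat.cast_sub (by omega)]
    ring
  have hup := ((tendsto_ratio_mean_degree hx 0 0).pow a).mul
    (tendsto_one_sub_pow_mul_exp_of_pow_div hpow r a a 0)
  have hlow := ((tendsto_ratio_mean_degree hx a a).pow a).mul
    (tendsto_one_sub_pow_mul_exp_of_pow_div hpow r a q₀ q₁)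
  rw [one_pow, one_mul] at hup hlow
  refine tendsto_of_tendsto_of_tendsto_of_le_of_le' hlow hup ?_ ?_
  · filter_upwards [hroom, hMa, hq, hx.eventually_gt_atTop 0, eventually_gt_atTop 0] with
      n h1 h2 h3 h4 hn
    have hn' : (0 : ℝ) < n := by positivity
    have h5 := le_patternProb (b := r * (n - r) - a) h2 (N := n.choose 2) (by omega) (by omega)
    have h6 : (((n.choose 2 : ℕ) : ℝ) - a - (r * (n - r) - a : ℕ)) ≠ 0 := by
      have : ((a + (r * (n - r) - a) : ℕ) : ℝ) < (n.choose 2 : ℕ) := Nat.cast_lt.2 (by omega)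
      rw [Nat.cast_add] at this
      linarith
    have h7 : (((n.choose 2 : ℕ) : ℝ) - M n - (r * (n - r) - a : ℕ)) /
        (((n.choose 2 : ℕ) : ℝ) - a - (r * (n - r) - a : ℕ)) =
        1 - ((n : ℝ) / 2 * x n - a) / ((n : ℝ) * (n - 1) / 2 - (q₀ + q₁ * n)) := by
      rw [← h3, ← Nat.cast_choose_two, ← hM n, ← sub_sub, one_sub_div h6]
      ring
    rw [h7, hM n, Nat.cast_choose_two] at h5
    rw [le_div_iff₀ (by positivity), div_pow _ (x n / n), Real.exp_neg]
    refine le_of_eq_of_le ?_ h5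
    field_simp
  · filter_upwards [hroom, hMa, hx.eventually_gt_atTop 0, eventually_gt_atTop 0] with
      n h1 h2 h4 hn
    have hn' : (0 : ℝ) < n := by positivity
    have h5 := patternProb_le (b := r * (n - r) - a) h2 (N := n.choose 2) (by omega) (by omega)
    have h6 : (((n.choose 2 : ℕ) : ℝ) - a) ≠ 0 := by
      have : (a : ℝ) < (n.choose 2 : ℕ) := Nat.cast_lt.2 (by omega)
      linarith
    have h7 : (((n.choose 2 : ℕ) : ℝ) - M n) / (((n.choose 2 : ℕ) : ℝ) - a) =
        1 - ((n : ℝ) / 2 * x n - a) / ((n : ℝ) * (n - 1) / 2 - (a + 0 * n)) := by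
      rw [← Nat.cast_choose_two, ← hM n, zero_mul, add_zero, one_sub_div h6]
      ring
    rw [h7, hM n, Nat.cast_choose_two] at h5
    rw [div_le_iff₀ (by positivity), div_pow _ (x n / n), Real.exp_neg, Nat.cast_zero, sub_zero,
      sub_zero]
    refine le_of_le_of_eq h5 ?_
    field_simp

lemma tendsto_choose_div_pow (j : ℕ) :
    Tendsto (fun n : ℕ => (n.choose j : ℝ) / (n : ℝ) ^ j) atTop (nhds (1 / j.factorial)) := by
  have hz : ∀ᶠ n : ℕ in atTop, (n : ℝ) ^ j / j.factorial ≠ 0 := by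
    filter_upwards [eventually_gt_atTop 0] with n hn
    positivity
  have h := ((isEquivalent_iff_tendsto_one hz).1 (isEquivalent_choose j)).div_const
    (j.factorial : ℝ)
  refine h.congr fun n => ?_
  have : (j.factorial : ℝ) ≠ 0 := by positivity
  simp only [Pi.div_apply]
  rw [div_div_eq_mul_div]
  field_simp

lemma tendsto_choose_sub_div_pow (r j : ℕ) :
    Tendsto (fun n : ℕ => ((n - r).choose j : ℝ) / (n : ℝ) ^ j) atTop
      (nhds (1 / j.factorial)) := by
  have h1 := (tendsto_choose_div_pow j).comp (tendsto_sub_atTop_nat r)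
  have h2 : Tendsto (fun n : ℕ => 1 - r * (1 / (n : ℝ))) atTop (nhds 1) := by
    simpa only [mul_zero, sub_zero] using
      (tendsto_one_div_atTop_nhds_zero_nat.const_mul (r : ℝ)).const_sub 1
  have h3 := h1.mul (h2.pow j)
  rw [one_pow, mul_one] at h3
  refine h3.congr' ?_
  filter_upwards [eventually_gt_atTop r] with n hn
  have h4 : (n : ℝ) ≠ 0 := by have : 0 < n := by omega
                              positivity
  have h5 : ((n - r : ℕ) : ℝ) ≠ 0 := by have : 0 < n - r := by omega
                                        positivity
  simp only [Function.comp_apply]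
  rw [show 1 - r * (1 / (n : ℝ)) = (n - r : ℕ) / n by
    rw [Nat.cast_sub hn.le]; field_simp, div_pow]
  field_simp

/-- The truncated binomial expansion is dominated by its last term. -/
lemma tendsto_sum_choose_mul_pow_div {x : ℕ → ℝ} (hx : Tendsto x atTop atTop) (d r : ℕ) :
    Tendsto (fun n : ℕ => (∑ j ∈ Finset.range (d + 1), ((n - r).choose j : ℝ) * (x n / n) ^ j) /
      (x n ^ d / d.factorial)) atTop (nhds 1) := by
  have h : ∀ j ∈ Finset.range (d + 1), Tendsto (fun n : ℕ =>
      ((n - r).choose j : ℝ) / (n : ℝ) ^ j * (x n ^ j / x n ^ d) * d.factorial) atTop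
      (nhds (if j = d then 1 else 0)) := by
    intro j hj
    rcases (Nat.lt_succ_iff.1 (Finset.mem_range.1 hj)).eq_or_lt with rfl | hjd
    · have h1 : Tendsto (fun n : ℕ => x n ^ j / x n ^ j) atTop (nhds 1) := by
        refine tendsto_const_nhds.congr' ?_
        filter_upwards [hx.eventually_gt_atTop 0] with n hn
        rw [div_self (pow_ne_zero _ hn.ne')]
      have := ((tendsto_choose_sub_div_pow r j).mul h1).mul_const (j.factorial : ℝ)
      simpa [Nat.factorial_ne_zero] using this
    · have h1 := (tendsto_pow_div_pow_atTop_zero (𝕜 := ℝ) hjd).comp hx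
      have := ((tendsto_choose_sub_div_pow r j).mul h1).mul_const (d.factorial : ℝ)
      simpa [hjd.ne] using this
  have h2 := tendsto_finsetSum _ h
  rw [Finset.sum_ite_eq' _ d, if_pos (Finset.self_mem_range_succ d)] at h2
  refine h2.congr fun n => ?_
  rw [Finset.sum_div]
  refine Finset.sum_congr rfl fun j _ => ?_
  rw [div_pow, div_div_eq_mul_div]
  ring

lemma tendsto_edges_div {M : ℕ → ℕ} {x : ℕ → ℝ} (hM : ∀ n : ℕ, (M n : ℝ) = n / 2 * x n)
    (hv : Tendsto (fun n : ℕ => x n / n) atTop (nhds 0)) (r : ℕ) :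
    Tendsto (fun n : ℕ => (M n : ℝ) / (n.choose 2 - (r * (n - r) : ℕ))) atTop (nhds 0) := by
  have hu : Tendsto (fun n : ℕ => (1 : ℝ) / n) atTop (nhds 0) := tendsto_one_div_atTop_nhds_zero_nat
  have hD : Tendsto (fun n : ℕ => 1 / 2 - 1 / (n : ℝ) / 2 - r * (1 / n) +
      r ^ 2 * (1 / (n : ℝ)) ^ 2) atTop (nhds (1 / 2)) := by
    have := (((hu.div_const 2).const_sub (1 / 2)).sub (hu.const_mul (r : ℝ))).add
      ((hu.pow 2).const_mul ((r : ℝ) ^ 2))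
    simpa using this
  have h := (hv.div_const 2).div hD (by norm_num)
  rw [zero_div, zero_div] at h
  refine h.congr' ?_
  filter_upwards [eventually_ge_atTop r, eventually_gt_atTop 0] with n hn hn0
  have hn' : (n : ℝ) ≠ 0 := by positivity
  simp only [Pi.div_apply]
  rw [hM n, Nat.cast_choose_two, Nat.cast_mul, Nat.cast_sub hn,
    ← mul_div_mul_right (x n / n / 2) _ (pow_ne_zero 2 hn')]
  congr 1
  · field_simp
  · field_simp
    ring

/-- The binomial moments of the number of vertices of degree at most `d` are asymptotically those
of a Poisson variable with mean `n x ^ d e ^ (-x) / d!`. -/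
lemma tendsto_binomialMoment_div {M : ℕ → ℕ} {x : ℕ → ℝ}
    (hM : ∀ n : ℕ, (M n : ℝ) = n / 2 * x n) (hx : Tendsto x atTop atTop)
    (hpow : ∀ j : ℕ, Tendsto (fun n : ℕ => x n ^ j / n) atTop (nhds 0)) (d r : ℕ) :
    Tendsto (fun n : ℕ => binomialMoment n (M n) d r /
      (n * (x n ^ d / d.factorial) * Real.exp (-x n)) ^ r) atTop (nhds (1 / r.factorial)) := by
  have hv : Tendsto (fun n : ℕ => x n / n) atTop (nhds 0) := by simpa using hpow 1
  set δ : ℕ → ℝ := fun n => ∑ a ∈ Finset.range (r * d + 1),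
    |patternProb (n.choose 2) (M n) a (r * (n - r) - a) /
      ((x n / n) ^ a * Real.exp (-(r * x n))) - 1| with hδ
  have hδ0 : Tendsto δ atTop (nhds 0) := by
    rw [← Finset.sum_const_zero (s := Finset.range (r * d + 1))]
    refine tendsto_finsetSum _ fun a _ => ?_
    have := ((tendsto_patternProb_div hM hx hpow r a).sub_const 1).abs
    rwa [sub_self, abs_zero] at this
  have hη0 := (tendsto_edges_div hM hv r).const_mul ((r : ℝ) ^ 2)
  rw [mul_zero] at hη0
  set main : ℕ → ℝ := fun n => (n.choose r : ℝ) / (n : ℝ) ^ r *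
    ((∑ j ∈ Finset.range (d + 1), ((n - r).choose j : ℝ) * (x n / n) ^ j) /
      (x n ^ d / d.factorial)) ^ r with hmain
  have hmain0 : Tendsto main atTop (nhds (1 / r.factorial)) := by
    have := (tendsto_choose_div_pow r).mul ((tendsto_sum_choose_mul_pow_div hx d r).pow r)
    rwa [one_pow, mul_one] at this
  have hup := (hδ0.const_add 1).mul hmain0
  have hlow := ((hη0.const_sub 1).mul (hδ0.const_sub 1)).mul hmain0
  rw [add_zero, one_mul] at hup
  rw [sub_zero, one_mul, one_mul] at hlow
  have hev : ∀ᶠ n : ℕ in atTop,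
      (1 - r ^ 2 * ((M n : ℝ) / (n.choose 2 - (r * (n - r) : ℕ)))) * (1 - δ n) * main n ≤
        binomialMoment n (M n) d r / (n * (x n ^ d / d.factorial) * Real.exp (-x n)) ^ r ∧
      binomialMoment n (M n) d r / (n * (x n ^ d / d.factorial) * Real.exp (-x n)) ^ r ≤
        (1 + δ n) * main n := by
    filter_upwards [eventually_edges_add_lt_choose_two hM hv r 0,
      eventually_le_edges hM hx (r * d + 1), eventually_ge_atTop (r + d), eventually_gt_atTop 0,
      hx.eventually_gt_atTop 0, hη0.eventually (gt_mem_nhds one_pos)] with n h1 h2 h3 h4 h5 h6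
    have hn : (0 : ℝ) < n := by positivity
    have hb := binomialMoment_bounds (z := x n / n) (E := Real.exp (-(r * x n))) (δ := δ n)
      h2 (by omega) (by omega) h3 ?_ h6.le
    · have hw : 0 < (n * (x n ^ d / d.factorial) * Real.exp (-x n)) ^ r := by positivity
      have hmm : (n.choose r : ℝ) * (Real.exp (-(r * x n)) *
          (∑ j ∈ Finset.range (d + 1), ((n - r).choose j : ℝ) * (x n / n) ^ j) ^ r) =
          main n * (n * (x n ^ d / d.factorial) * Real.exp (-x n)) ^ r := by
        rw [← mul_neg, Real.exp_nat_mul, hmain]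
        simp only [mul_pow, div_pow]
        field_simp
      rw [hmm] at hb
      rw [div_le_iff₀ hw, le_div_iff₀ hw]
      exact ⟨by simpa only [mul_assoc] using hb.2, by simpa only [mul_assoc] using hb.1⟩
    · intro a ha
      have hp : 0 < (x n / n) ^ a * Real.exp (-(r * x n)) := by positivity
      rw [← div_le_iff₀ hp]
      refine le_trans (le_of_eq ?_) (Finset.single_le_sum (fun a _ => abs_nonneg _)
        (Finset.mem_range.2 (Nat.lt_succ_of_le ha)))
      rw [div_sub_one hp.ne', abs_div, abs_of_pos hp]
  exact tendsto_of_tendsto_of_tendsto_of_le_of_le' hlow hup (hev.mono fun n h => h.1)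
    (hev.mono fun n h => h.2)

lemma abs_ite_sub_alternating_sum_choose_le (Y m : ℕ) :
    |(if Y = 0 then 1 else 0) - ∑ i ∈ Finset.range (m + 1), (-1 : ℝ) ^ i * Y.choose i| ≤
      Y.choose m := by
  rcases Y with _ | Y
  · rw [Finset.sum_range_succ', Finset.sum_eq_zero fun i _ => by simp]
    simp
  · have h : ∑ i ∈ Finset.range (m + 1), (-1 : ℝ) ^ i * (Y + 1).choose i =
        (-1 : ℝ) ^ m * Y.choose m := by
      exact_mod_cast Int.alternating_sum_range_choose_eq_choose
    rw [h, if_neg Y.succ_ne_zero, zero_sub, abs_neg, abs_mul, abs_neg_one_pow, one_mul,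
      Nat.abs_cast]
    exact_mod_cast Nat.choose_le_choose m Y.le_succ

lemma gnmProb_eq_sum (n M : ℕ) (A : Set (SimpleGraph (Fin n))) :
    gnmProb n M A = (∑ G ∈ gnmGraphs n M, if G ∈ A then (1 : ℝ) else 0) /
      ((n.choose 2).choose M : ℕ) := by
  rw [gnmProb_eq, Finset.sum_boole]

/-- The Bonferroni inequalities for the number of vertices of degree at most `d`. -/
lemma abs_gnmProb_lowDegree_eq_empty_sub_le (n M d m : ℕ) :
    |gnmProb n M {G | lowDegree d G = ∅} -
      ∑ i ∈ Finset.range (m + 1), (-1) ^ i * binomialMoment n M d i| ≤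
      binomialMoment n M d m := by
  have h : gnmProb n M {G | lowDegree d G = ∅} -
      ∑ i ∈ Finset.range (m + 1), (-1) ^ i * binomialMoment n M d i =
      (∑ G ∈ gnmGraphs n M, ((if (lowDegree d G).card = 0 then 1 else 0) -
        ∑ i ∈ Finset.range (m + 1), (-1 : ℝ) ^ i * (lowDegree d G).card.choose i)) /
        ((n.choose 2).choose M : ℕ) := by
    rw [gnmProb_eq_sum, Finset.sum_sub_distrib, sub_div, Finset.sum_comm,
      Finset.sum_div (Finset.range (m + 1))]
    simp only [Set.mem_ofPred_eq, Finset.card_eq_zero, binomialMoment, Finset.mul_sum,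
      mul_div_assoc']
    congr!
  rw [h, abs_div, Nat.abs_cast, binomialMoment]
  gcongr
  refine (Finset.abs_sum_le_sum_abs _ _).trans (Finset.sum_le_sum fun G _ => ?_)
  exact abs_ite_sub_alternating_sum_choose_le _ _

/-- A second moment bound for the absence of vertices of degree at most `d`. -/
lemma gnmProb_lowDegree_eq_empty_le (n M d : ℕ) {w : ℝ} (hw : 0 < w) :
    gnmProb n M {G | lowDegree d G = ∅} ≤
      2 * (binomialMoment n M d 2 / w ^ 2) + binomialMoment n M d 1 / w * w⁻¹ -
        2 * (binomialMoment n M d 1 / w) + binomialMoment n M d 0 := by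
  rw [gnmProb_eq_sum]
  have h : 2 * (binomialMoment n M d 2 / w ^ 2) + binomialMoment n M d 1 / w * w⁻¹ -
      2 * (binomialMoment n M d 1 / w) + binomialMoment n M d 0 =
      (∑ G ∈ gnmGraphs n M, (2 * (((lowDegree d G).card.choose 2 : ℝ) / w ^ 2) +
        ((lowDegree d G).card.choose 1 : ℝ) / w * w⁻¹ -
        2 * (((lowDegree d G).card.choose 1 : ℝ) / w) + ((lowDegree d G).card.choose 0 : ℝ))) /
        ((n.choose 2).choose M : ℕ) := by
    simp only [binomialMoment, Finset.sum_add_distrib, Finset.sum_sub_distrib, ← Finset.mul_sum,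
      ← Finset.sum_div, ← Finset.sum_mul]
    ring
  rw [h]
  gcongr with G
  have h2 : 2 * (((lowDegree d G).card.choose 2 : ℝ) / w ^ 2) +
      ((lowDegree d G).card.choose 1 : ℝ) / w * w⁻¹ -
      2 * (((lowDegree d G).card.choose 1 : ℝ) / w) + ((lowDegree d G).card.choose 0 : ℝ) =
      ((lowDegree d G).card / w - 1) ^ 2 := by
    rw [Nat.cast_choose_two, Nat.choose_one_right, Nat.choose_zero_right]
    field_simp
    push_cast
    ring
  rw [h2]
  split_ifs with h0
  · rw [Set.mem_ofPred_eq] at h0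
    simp [h0]
  · positivity

lemma tendsto_gnmProb_lowDegree_eq_empty {M : ℕ → ℕ} {d : ℕ} {lam : ℝ}
    (h : ∀ r : ℕ, Tendsto (fun n => binomialMoment n (M n) d r) atTop
      (nhds (lam ^ r / r.factorial))) :
    Tendsto (fun n => gnmProb n (M n) {G | lowDegree d G = ∅}) atTop
      (nhds (Real.exp (-lam))) := by
  rw [Metric.tendsto_nhds]
  intro ε hε
  have h1 : Tendsto (fun m : ℕ => ∑ i ∈ Finset.range (m + 1), (-1) ^ i * (lam ^ i / i.factorial))
      atTop (nhds (Real.exp (-lam))) := by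
    have := (NormedSpace.expSeries_div_hasSum_exp (-lam)).tendsto_sum_nat.comp
      (tendsto_add_atTop_nat 1)
    rw [← Real.exp_eq_exp_ℝ] at this
    refine this.congr fun m => Finset.sum_congr rfl fun i _ => ?_
    rw [neg_pow, mul_div_assoc]
  have h2 : Tendsto (fun m : ℕ => lam ^ m / m.factorial) atTop (nhds 0) :=
    FloorSemiring.tendsto_pow_div_factorial_atTop lam
  obtain ⟨m, hm1, hm2⟩ := ((h1.eventually (Metric.ball_mem_nhds _ (by positivity : 0 < ε / 3))).and
    (h2.eventually (gt_mem_nhds (by positivity : 0 < ε / 3)))).exists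
  have h3 : Tendsto (fun n => ∑ i ∈ Finset.range (m + 1), (-1) ^ i * binomialMoment n (M n) d i)
      atTop (nhds (∑ i ∈ Finset.range (m + 1), (-1) ^ i * (lam ^ i / i.factorial))) :=
    tendsto_finsetSum _ fun i _ => (h i).const_mul _
  filter_upwards [h3.eventually (Metric.ball_mem_nhds _ (by positivity : 0 < ε / 3)),
    (h m).eventually (gt_mem_nhds hm2)] with n hn1 hn2
  have h4 := abs_gnmProb_lowDegree_eq_empty_sub_le n (M n) d m
  rw [Real.dist_eq] at hm1 hn1 ⊢
  rw [abs_lt] at hm1 hn1 ⊢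
  rw [abs_le] at h4
  constructor <;> linarith [h4.1, h4.2, hm1.1, hm1.2, hn1.1, hn1.2]

lemma tendsto_gnmProb_lowDegree_eq_empty_of_mean {M : ℕ → ℕ} {x : ℕ → ℝ} {d : ℕ} {lam : ℝ}
    (hM : ∀ n : ℕ, (M n : ℝ) = n / 2 * x n) (hx : Tendsto x atTop atTop)
    (hpow : ∀ j : ℕ, Tendsto (fun n : ℕ => x n ^ j / n) atTop (nhds 0))
    (hw : Tendsto (fun n : ℕ => n * (x n ^ d / d.factorial) * Real.exp (-x n)) atTop (nhds lam)) :
    Tendsto (fun n => gnmProb n (M n) {G | lowDegree d G = ∅}) atTop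
      (nhds (Real.exp (-lam))) := by
  refine tendsto_gnmProb_lowDegree_eq_empty fun r => ?_
  have h := (tendsto_binomialMoment_div hM hx hpow d r).mul (hw.pow r)
  rw [one_div_mul_eq_div] at h
  refine h.congr' ?_
  filter_upwards [hx.eventually_gt_atTop 0, eventually_gt_atTop 0] with n h1 h2
  have : (n : ℝ) * (x n ^ d / d.factorial) * Real.exp (-x n) ≠ 0 := by positivity
  exact div_mul_cancel₀ _ (pow_ne_zero r this)

lemma tendsto_gnmProb_lowDegree_eq_empty_of_mean_atTop {M : ℕ → ℕ} {x : ℕ → ℝ} {d : ℕ}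
    (hM : ∀ n : ℕ, (M n : ℝ) = n / 2 * x n) (hx : Tendsto x atTop atTop)
    (hpow : ∀ j : ℕ, Tendsto (fun n : ℕ => x n ^ j / n) atTop (nhds 0))
    (hw : Tendsto (fun n : ℕ => n * (x n ^ d / d.factorial) * Real.exp (-x n)) atTop atTop) :
    Tendsto (fun n => gnmProb n (M n) {G | lowDegree d G = ∅}) atTop (nhds 0) := by
  have h0 := tendsto_binomialMoment_div hM hx hpow d 0
  have h1 := tendsto_binomialMoment_div hM hx hpow d 1
  have h2 := tendsto_binomialMoment_div hM hx hpow d 2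
  have h := (((h2.const_mul 2).add (h1.mul (tendsto_inv_atTop_zero.comp hw))).sub
    (h1.const_mul 2)).add h0
  rw [show 2 * (1 / (Nat.factorial 2 : ℝ)) + 1 / (Nat.factorial 1 : ℝ) * 0 -
    2 * (1 / (Nat.factorial 1 : ℝ)) + 1 / (Nat.factorial 0 : ℝ) = 0 by norm_num [Nat.factorial]] at h
  simp only [pow_zero, pow_one, div_one] at h
  refine squeeze_zero' (Eventually.of_forall fun n => gnmProb_nonneg _ _ _) ?_ h
  filter_upwards [hw.eventually_gt_atTop 0] with n hn
  exact gnmProb_lowDegree_eq_empty_le n (M n) d hn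

lemma gnmProb_le_vertexConnectivity_le (n M d : ℕ) :
    gnmProb n M {G | d + 1 ≤ vertexConnectivity G} ≤ gnmProb n M {G | lowDegree d G = ∅} := by
  refine gnmProb_mono n M fun G _ hG => ?_
  rw [Set.mem_ofPred_eq] at hG ⊢
  refine Finset.filter_eq_empty_iff.2 fun v _ h => ?_
  have := le_degree_of_le_vertexConnectivity hG v
  omega

lemma gnmProb_lowDegree_eq_empty_le_add {n M d k : ℕ} (hd : d ≤ k) (hn : d + 1 < n) :
    gnmProb n M {G | lowDegree d G = ∅} ≤
      gnmProb n M {G | d + 1 ≤ vertexConnectivity G} + gnmProb n M {G | HasSmallCut (k + 1) G} := by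
  refine (gnmProb_mono n M fun G _ hG => ?_).trans (gnmProb_union_le n M _ _)
  by_cases h : d + 1 ≤ vertexConnectivity G
  · exact Or.inl h
  · refine Or.inr ((hasSmallCut_of_degree hn (fun v => ?_) h).mono (by omega))
    have := Finset.filter_eq_empty_iff.1 hG (Finset.mem_univ v)
    omega

lemma tendsto_gnmProb_le_vertexConnectivity {M : ℕ → ℕ} {d k : ℕ} {p : ℝ} (hd : d ≤ k)
    (h : Tendsto (fun n => gnmProb n (M n) {G | lowDegree d G = ∅}) atTop (nhds p))
    (hcut : Tendsto (fun n => gnmProb n (M n) {G | HasSmallCut (k + 1) G}) atTop (nhds 0)) :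
    Tendsto (fun n => gnmProb n (M n) {G | d + 1 ≤ vertexConnectivity G}) atTop (nhds p) := by
  have h1 := h.sub hcut
  rw [sub_zero] at h1
  refine tendsto_of_tendsto_of_tendsto_of_le_of_le' h1 h ?_
    (Eventually.of_forall fun n => gnmProb_le_vertexConnectivity_le n (M n) d)
  filter_upwards [eventually_gt_atTop (d + 1)] with n hn
  have := gnmProb_lowDegree_eq_empty_le_add (M := M n) hd hn
  linarith

lemma gnmProb_vertexConnectivity_eq (n M j : ℕ) :
    gnmProb n M {G | vertexConnectivity G = j} =
      gnmProb n M {G | j ≤ vertexConnectivity G} -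
        gnmProb n M {G | j + 1 ≤ vertexConnectivity G} := by
  simp only [gnmProb_eq_sum, ← sub_div, ← Finset.sum_sub_distrib, Set.mem_ofPred_eq]
  congr 1
  refine Finset.sum_congr rfl fun G _ => ?_
  rcases lt_trichotomy (vertexConnectivity G) j with h | h | h
  · rw [if_neg (by omega), if_neg (by omega), if_neg (by omega), sub_zero]
  · rw [if_pos h, if_pos (by omega), if_neg (by omega), sub_zero]
  · rw [if_neg (by omega), if_pos (by omega), if_pos (by omega), sub_self]

lemma gnmProb_univ {n M : ℕ} (h : M ≤ n.choose 2) : gnmProb n M Set.univ = 1 := by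
  rw [gnmProb_eq]
  simp only [Set.mem_univ, Finset.filter_true, card_gnmGraphs]
  have h0 := (Nat.choose_pos h).ne'
  exact div_self (Nat.cast_ne_zero.2 h0)

/-- Bollobás–Thomason: if `M = (n/2)(log n + k log log n + y + o(1))`, then
`Pr[κ(G(n,M)) = k] → 1 − exp(−e^{−y}/k!)` and `Pr[κ(G(n,M)) = k+1] → exp(−e^{−y}/k!)`. -/
theorem bollobas_thomason (k : ℕ) (y : ℝ) (M : ℕ → ℕ) (e : ℕ → ℝ)
    (he : Tendsto e atTop (nhds 0))
    (hM : ∀ n : ℕ, (M n : ℝ) = (n : ℝ) / 2 * (Real.log n +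
      (k : ℝ) * Real.log (Real.log n) + y + e n)) :
    Tendsto (fun n : ℕ =>
      gnmProb n (M n) {G : SimpleGraph (Fin n) | vertexConnectivity G = k})
      atTop (nhds (1 - Real.exp (-(Real.exp (-y) / (k.factorial : ℝ))))) ∧
    Tendsto (fun n : ℕ =>
      gnmProb n (M n) {G : SimpleGraph (Fin n) | vertexConnectivity G = k + 1})
      atTop (nhds (Real.exp (-(Real.exp (-y) / (k.factorial : ℝ))))) := by
  set x : ℕ → ℝ := fun n => Real.log n + (k : ℝ) * Real.log (Real.log n) + y + e n with hxdef
  have hlogn : Tendsto (fun n : ℕ => Real.log n) atTop atTop :=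
    Real.tendsto_log_atTop.comp tendsto_natCast_atTop_atTop
  have hratio : Tendsto (fun n : ℕ => x n / Real.log n) atTop (nhds 1) := by
    have h1 : Tendsto (fun n : ℕ => Real.log (Real.log n) / Real.log n) atTop (nhds 0) :=
      Real.isLittleO_log_id_atTop.tendsto_div_nhds_zero.comp hlogn
    have h2 : Tendsto (fun n : ℕ => (y + e n) / Real.log n) atTop (nhds 0) :=
      (he.const_add y).div_atTop hlogn
    have h3 := ((h1.const_mul (k : ℝ)).const_add 1).add h2
    rw [mul_zero, add_zero, add_zero] at h3
    refine h3.congr' ?_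
    filter_upwards [hlogn.eventually_gt_atTop 0] with n hn
    simp only [hxdef]
    field_simp
    ring
  have hx : Tendsto x atTop atTop := by
    refine (hratio.pos_mul_atTop one_pos hlogn).congr' ?_
    filter_upwards [hlogn.eventually_gt_atTop 0] with n hn
    exact div_mul_cancel₀ _ hn.ne'
  have hpow : ∀ j : ℕ, Tendsto (fun n : ℕ => x n ^ j / n) atTop (nhds 0) := by
    intro j
    have h1 : Tendsto (fun n : ℕ => Real.log n ^ j / n) atTop (nhds 0) :=
      (Real.isLittleO_pow_log_id_atTop (n := j)).tendsto_div_nhds_zero.comp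
        tendsto_natCast_atTop_atTop
    have h2 := (hratio.pow j).mul h1
    rw [mul_zero] at h2
    refine h2.congr' ?_
    filter_upwards [hlogn.eventually_gt_atTop 0] with n hn
    have := hn.ne'
    rw [div_pow]
    field_simp
  have hlog : ∀ᶠ n : ℕ in atTop, Real.log n - (1 - y) ≤ x n := by
    filter_upwards [hlogn.eventually_ge_atTop 1,
      he.eventually (lt_mem_nhds (by norm_num : (-1 : ℝ) < 0))] with n h1 h2
    have := mul_nonneg k.cast_nonneg (Real.log_nonneg h1)
    simp only [hxdef]
    linarith
  have hcut := tendsto_gnmProb_hasSmallCut k hM hx hpow hlog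
  have hbase : Tendsto (fun n : ℕ => n * x n ^ k * Real.exp (-x n)) atTop
      (nhds (Real.exp (-y))) := by
    have h1 : Tendsto (fun n => Real.exp (-y - e n)) atTop (nhds (Real.exp (-y))) := by
      have := (Real.continuous_exp.tendsto _).comp (he.const_sub (-y))
      rwa [sub_zero] at this
    have h2 := (hratio.pow k).mul h1
    rw [one_pow, one_mul] at h2
    refine h2.congr' ?_
    filter_upwards [hlogn.eventually_gt_atTop 0, eventually_gt_atTop 0] with n hn hn0
    have hn' : (0 : ℝ) < n := by positivity
    have h3 : Real.exp (-x n) = Real.exp (-y - e n) / (n * Real.log n ^ k) := by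
      rw [← Real.exp_log hn', Real.log_exp, ← Real.exp_log (pow_pos hn k), ← Real.exp_add,
        ← Real.exp_sub, Real.log_pow]
      congr 1
      simp only [hxdef]
      ring
    have := hn.ne'
    rw [h3, div_pow]
    field_simp
  have hMx : ∀ n : ℕ, (M n : ℝ) = n / 2 * x n := hM
  clear_value x
  have hk1 : Tendsto (fun n => gnmProb n (M n) {G | k + 1 ≤ vertexConnectivity G}) atTop
      (nhds (Real.exp (-(Real.exp (-y) / (k.factorial : ℝ))))) := by
    refine tendsto_gnmProb_le_vertexConnectivity le_rfl
      (tendsto_gnmProb_lowDegree_eq_empty_of_mean hMx hx hpow ?_) hcut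
    refine (hbase.div_const (k.factorial : ℝ)).congr fun n => ?_
    ring
  have hk2 : Tendsto (fun n => gnmProb n (M n) {G | k + 1 + 1 ≤ vertexConnectivity G}) atTop
      (nhds 0) := by
    refine squeeze_zero (fun n => gnmProb_nonneg _ _ _)
      (fun n => gnmProb_le_vertexConnectivity_le n (M n) (k + 1))
      (tendsto_gnmProb_lowDegree_eq_empty_of_mean_atTop hMx hx hpow ?_)
    refine ((hbase.div_const ((k + 1).factorial : ℝ)).pos_mul_atTop (by positivity) hx).congr
      fun n => ?_
    ring
  have hk0 : Tendsto (fun n => gnmProb n (M n) {G | k ≤ vertexConnectivity G}) atTop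
      (nhds 1) := by
    rcases k with _ | d
    · refine tendsto_const_nhds.congr' ?_
      filter_upwards [eventually_edges_add_lt_choose_two hMx (by simpa using hpow 1) 0 0] with n hn
      rw [← gnmProb_univ (show M n ≤ n.choose 2 by omega)]
      simp
    · rw [← Real.exp_zero, ← neg_zero]
      refine tendsto_gnmProb_le_vertexConnectivity d.le_succ
        (tendsto_gnmProb_lowDegree_eq_empty_of_mean hMx hx hpow ?_) hcut
      have h1 := (hbase.div_const (d.factorial : ℝ)).mul (tendsto_inv_atTop_zero.comp hx)
      rw [mul_zero] at h1
      refine h1.congr' ?_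
      filter_upwards [hx.eventually_gt_atTop 0] with n hn
      have := hn.ne'
      simp only [Function.comp_apply]
      field_simp
      ring
  simp only [gnmProb_vertexConnectivity_eq]
  refine ⟨hk0.sub hk1, ?_⟩
  have h := hk1.sub hk2
  rwa [sub_zero] at h
end
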